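/- Outer bound with feedback. Consider the same setting as Theorem 1, but where the encoders may use noiseless instantaneous output feedback: x_{1i} : {1,…,M₁} × 𝒴^{i−1} → 𝒳₁ and x_{2i} : {1,…,M₂} × 𝒴^{i−1} → 𝒳₂, and conditionally on W₁ = w₁, W₂ = w₂ and Y^{i−1} = y^{i−1}, the output Y_i is distributed according to p(·|x_{1i}(w₁,y^{i−1}), x_{2i}(w₂,y^{i−1})). Let 0 < r₁ ≤ 1, 0 ≤ r₂ ≤ 1, s := r₂/r₁, and suppose (R₁,R₂) is achievable in 𝒞_{r₁,r₂} by such feedback codes (for every ε > 0 there is a feedback code with log M₁/E[N₁] ≥ R₁, log M₂/E[N₂] ≥ R₂, error probability < ε, E[N]/E[N₁] ≥ r₁, E[N]/E[N₂] ≥ r₂ and E[N₁]/E[N₂] = s, with E[N₁], E[N₂] → ∞ as ε → 0). Then there exists a joint distribution of (X₁,X₂,Y) of the form p(x₁,x₂)p(y|x₁,x₂) (an arbitrary joint input distribution, with Y related to the inputs through the channel) such that: R₁ ≤ r₁·I(X₁;Y|X₂) + (1−r₁)·C₁; R₂ ≤ r₂·I(X₂;Y|X₁) + (1−r₂)·C₂;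 and s·R₁ + R₂ ≤ r₂·I(X₁,X₂;Y) + s(1−r₁)·C₁ + (1−r₂)·C₂. -/

import Mathlib

open MeasureTheory

noncomputable section

/-- `f` is a probability mass function on the finite type `α`. -/
def IsPMF {α : Type*} [Fintype α] (f : α → ℝ) : Prop :=
  (∀ a, 0 ≤ f a) ∧ ∑ a, f a = 1

/-- The received prefix `Y^N` of random length `N` (encoded with indicators:
`some (Y i ω)` while `i < N ω`, `none` afterwards). -/
def Yprefix {Ω 𝒴 : Type*} (Y : ℕ → Ω → 𝒴) (N : Ω → ℕ) (ω : Ω) : ℕ → Option 𝒴 :=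
  fun i => if i < N ω then some (Y i ω) else none

/-- `I(X₁;Y|X₂)` for an arbitrary joint input distribution `π` on
`𝒳₁ × 𝒳₂`, the output being related to the inputs through the channel. -/
def fbMI1 {X1 X2 Y : Type*} [Fintype X1] [Fintype X2] [Fintype Y]
    (ch : X1 → X2 → Y → ℝ) (π : X1 × X2 → ℝ) : ℝ :=
  ∑ x1, ∑ x2, ∑ y, π (x1, x2) * ch x1 x2 y *
    Real.log (ch x1 x2 y /
      ((∑ x1', π (x1', x2) * ch x1' x2 y) / (∑ x1', π (x1', x2))))

/-- `I(X₂;Y|X₁)` for a joint input distribution `π`. -/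
def fbMI2 {X1 X2 Y : Type*} [Fintype X1] [Fintype X2] [Fintype Y]
    (ch : X1 → X2 → Y → ℝ) (π : X1 × X2 → ℝ) : ℝ :=
  ∑ x1, ∑ x2, ∑ y, π (x1, x2) * ch x1 x2 y *
    Real.log (ch x1 x2 y /
      ((∑ x2', π (x1, x2') * ch x1 x2' y) / (∑ x2', π (x1, x2'))))

/-- `I(X₁,X₂;Y)` for a joint input distribution `π`. -/
def fbMI12 {X1 X2 Y : Type*} [Fintype X1] [Fintype X2] [Fintype Y]
    (ch : X1 → X2 → Y → ℝ) (π : X1 × X2 → ℝ) : ℝ :=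
  ∑ x1, ∑ x2, ∑ y, π (x1, x2) * ch x1 x2 y *
    Real.log (ch x1 x2 y / (∑ x1', ∑ x2', π (x1', x2') * ch x1' x2' y))

/-- `I(X₁;Y|X₂)` for product inputs `q₁ × q₂` (no time sharing). -/
def miNoQ1 {X1 X2 Y : Type*} [Fintype X1] [Fintype X2] [Fintype Y]
    (ch : X1 → X2 → Y → ℝ) (q1 : X1 → ℝ) (q2 : X2 → ℝ) : ℝ :=
  ∑ x1, ∑ x2, ∑ y, q1 x1 * q2 x2 * ch x1 x2 y *
    Real.log (ch x1 x2 y / (∑ x1', q1 x1' * ch x1' x2 y))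

/-- `I(X₂;Y|X₁)` for product inputs. -/
def miNoQ2 {X1 X2 Y : Type*} [Fintype X1] [Fintype X2] [Fintype Y]
    (ch : X1 → X2 → Y → ℝ) (q1 : X1 → ℝ) (q2 : X2 → ℝ) : ℝ :=
  ∑ x1, ∑ x2, ∑ y, q1 x1 * q2 x2 * ch x1 x2 y *
    Real.log (ch x1 x2 y / (∑ x2', q2 x2' * ch x1 x2' y))

/-- `C₁ = max_{p(x₁)p(x₂)} I(X₁;Y|X₂)`. -/
def Cap1 {X1 X2 Y : Type*} [Fintype X1] [Fintype X2] [Fintype Y]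
    (ch : X1 → X2 → Y → ℝ) : ℝ :=
  sSup {c : ℝ | ∃ q1 : X1 → ℝ, ∃ q2 : X2 → ℝ,
    IsPMF q1 ∧ IsPMF q2 ∧ c = miNoQ1 ch q1 q2}

/-- `C₂ = max_{p(x₁)p(x₂)} I(X₂;Y|X₁)`. -/
def Cap2 {X1 X2 Y : Type*} [Fintype X1] [Fintype X2] [Fintype Y]
    (ch : X1 → X2 → Y → ℝ) : ℝ :=
  sSup {c : ℝ | ∃ q1 : X1 → ℝ, ∃ q2 : X2 → ℝ,
    IsPMF q1 ∧ IsPMF q2 ∧ c = miNoQ2 ch q1 q2}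

namespace FB

set_option linter.unusedSectionVars false

open Finset

/-- real indicator -/
def ind (p : Prop) : ℝ := by classical exact if p then 1 else 0

lemma ind_true {p : Prop} (h : p) : ind p = 1 := by simp [ind, h]
lemma ind_false {p : Prop} (h : ¬ p) : ind p = 0 := by simp [ind, h]
lemma ind_nonneg (p : Prop) : 0 ≤ ind p := by unfold ind; split_ifs <;> norm_num
lemma ind_le_one (p : Prop) : ind p ≤ 1 := by unfold ind; split_ifs <;> norm_num
lemma ind_cases (p : Prop) : ind p = 0 ∨ ind p = 1 := by unfold ind; split_ifs <;> simp
lemma ind_mono {p q : Prop} (h : p → q) : ind p ≤ ind q := by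
  by_cases hp : p
  · rw [ind_true hp, ind_true (h hp)]
  · rw [ind_false hp]; exact ind_nonneg q
lemma ind_not (p : Prop) : ind (¬ p) = 1 - ind p := by
  by_cases hp : p
  · rw [ind_true hp, ind_false (by simpa using hp)]; simp
  · rw [ind_false hp, ind_true hp]; simp
lemma ind_and (p q : Prop) : ind (p ∧ q) = ind p * ind q := by
  by_cases hp : p <;> by_cases hq : q <;> simp [ind, hp, hq]

/-- extend a finite word by a default letter -/
def ext {A : Type} (z : A) (n : ℕ) (y : Fin n → A) : ℕ → A :=
  fun i => if h : i < n then y ⟨i, h⟩ else z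

/-- sum over all words of length `n` -/
def S {A : Type} [Fintype A] (z : A) (n : ℕ) (f : (ℕ → A) → ℝ) : ℝ :=
  ∑ y : Fin n → A, f (ext z n y)

/-- depends only on the first `n` letters -/
def Dep {A B : Type} (n : ℕ) (f : (ℕ → A) → B) : Prop :=
  ∀ y y' : ℕ → A, (∀ j < n, y j = y' j) → f y = f y'

/-- product of kernel values along a path -/
def pr {A : Type} (k : ℕ → (ℕ → A) → A → ℝ) (n : ℕ) (y : ℕ → A) : ℝ :=
  ∏ i ∈ range n, k i y (y i)

/-- causal probability kernel -/
structure Ker {A : Type} [Fintype A] (k : ℕ → (ℕ → A) → A → ℝ) : Prop where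
  dep : ∀ i, Dep i (k i)
  nn : ∀ i y a, 0 ≤ k i y a
  one : ∀ i y, ∑ a, k i y a = 1

section
variable {A : Type} [Fintype A] (z : A)

lemma Dep.mono {A B : Type} {m n : ℕ} {f : (ℕ → A) → B} (h : Dep m f) (hmn : m ≤ n) : Dep n f :=
  fun y y' hy => h y y' fun j hj => hy j (lt_of_lt_of_le hj hmn)

open Classical in
lemma Dep.upd {A B : Type} {n m : ℕ} {f : (ℕ → A) → B} (h : Dep n f) (hm : n ≤ m) (y : ℕ → A) (a : A) :
    f (Function.update y m a) = f y :=
  h _ _ fun j hj => Function.update_of_ne (by omega) _ _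

lemma ext_dep {B : Type} {n : ℕ} {f : (ℕ → A) → B} (h : Dep n f) (y : ℕ → A) :
    f (ext z n (fun i => y i)) = f y :=
  h _ _ fun j hj => by simp [ext, hj]

lemma S_mono {n : ℕ} {f g : (ℕ → A) → ℝ} (h : ∀ y, f y ≤ g y) : S z n f ≤ S z n g :=
  sum_le_sum fun _ _ => h _
lemma S_nonneg {n : ℕ} {f : (ℕ → A) → ℝ} (h : ∀ y, 0 ≤ f y) : 0 ≤ S z n f :=
  sum_nonneg fun _ _ => h _
lemma S_add (n : ℕ) (f g : (ℕ → A) → ℝ) : S z n (fun y => f y + g y) = S z n f + S z n g := by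
  simp [S, sum_add_distrib]
lemma S_sub (n : ℕ) (f g : (ℕ → A) → ℝ) : S z n (fun y => f y - g y) = S z n f - S z n g := by
  simp [S, sum_sub_distrib]
lemma S_mul (n : ℕ) (c : ℝ) (f : (ℕ → A) → ℝ) : S z n (fun y => c * f y) = c * S z n f := by
  simp [S, mul_sum]
lemma S_sum {J : Type} (s : Finset J) (n : ℕ) (f : J → (ℕ → A) → ℝ) :
    S z n (fun y => ∑ j ∈ s, f j y) = ∑ j ∈ s, S z n (f j) := by
  simp only [S]; rw [sum_comm]
lemma S_congr {n : ℕ} {f g : (ℕ → A) → ℝ} (h : ∀ y, f y = g y) : S z n f = S z n g := by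
  simp [S, h]
lemma S_single {n : ℕ} {f : (ℕ → A) → ℝ} (h : ∀ y, 0 ≤ f y) (hd : Dep n f) (y : ℕ → A) :
    f y ≤ S z n f := by
  rw [← ext_dep z hd y]
  exact single_le_sum (f := fun y => f (ext z n y)) (fun _ _ => h _) (mem_univ _)

open Classical in
lemma S_succ (n : ℕ) (f : (ℕ → A) → ℝ) :
    S z (n+1) f = S z n (fun y => ∑ a, f (Function.update y n a)) := by
  simp only [S]
  rw [← (Fin.snocEquiv (fun _ => A)).sum_comp, Fintype.sum_prod_type, sum_comm]
  refine sum_congr rfl fun y _ => sum_congr rfl fun a _ => ?_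
  congr 1
  funext i
  simp only [ext, Fin.snocEquiv, Equiv.coe_fn_mk, Function.update_apply, Fin.snoc]
  rcases lt_trichotomy i n with h | h | h
  · have : i ≠ n := by omega
    simp [h, this, Nat.lt_succ_of_lt h]
  · subst h; simp
  · have : i ≠ n := by omega
    simp [this, show ¬ i < n by omega, show ¬ i < n + 1 by omega]

lemma pr_dep {k : ℕ → (ℕ → A) → A → ℝ} (hk : ∀ i, Dep i (k i)) (n : ℕ) : Dep n (pr k n) := by
  intro y y' h
  refine prod_congr rfl fun i hi => ?_
  rw [mem_range] at hi
  rw [hk i y y' (fun j hj => h j (by omega)), h i hi]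

lemma pr_nonneg {k : ℕ → (ℕ → A) → A → ℝ} (hk : Ker k) (n : ℕ) (y) : 0 ≤ pr k n y :=
  prod_nonneg fun _ _ => hk.nn _ _ _

open Classical in
lemma S_pr_succ {k : ℕ → (ℕ → A) → A → ℝ} (hk : ∀ i, Dep i (k i)) (n : ℕ) (h : (ℕ → A) → ℝ) :
    S z (n+1) (fun y => pr k (n+1) y * h y) =
      S z n (fun y => pr k n y * ∑ a, k n y a * h (Function.update y n a)) := by
  rw [S_succ]
  refine S_congr z fun y => ?_
  rw [mul_sum]
  refine sum_congr rfl fun a _ => ?_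
  have h1 : pr k (n+1) (Function.update y n a) = pr k n y * k n y a := by
    rw [pr, prod_range_succ]
    have h2 := (pr_dep hk n).upd le_rfl y a
    rw [pr] at h2
    rw [h2, (hk n).upd le_rfl y a]; simp
  rw [h1]; ring

lemma S_pr_ext {k : ℕ → (ℕ → A) → A → ℝ} (hk : Ker k) {m n : ℕ} (hmn : m ≤ n)
    {F : (ℕ → A) → ℝ} (hF : Dep m F) :
    S z n (fun y => pr k n y * F y) = S z m (fun y => pr k m y * F y) := by
  classical
  induction n, hmn using Nat.le_induction with
  | base => rfl
  | succ n hn ih =>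
    rw [S_pr_succ z hk.dep, ← ih]
    refine S_congr z fun y => ?_
    congr 1
    simp_rw [hF.upd hn, ← sum_mul, hk.one, one_mul]

lemma S_pr_one {k : ℕ → (ℕ → A) → A → ℝ} (hk : Ker k) (n : ℕ) :
    S z n (pr k n) = 1 := by
  have := S_pr_ext z hk (Nat.zero_le n) (F := fun _ => 1) (fun _ _ _ => rfl)
  simp only [mul_one] at this
  rw [show pr k n = fun y => pr k n y from rfl, this]
  simp [S, pr]

lemma S_pr_div {k : ℕ → (ℕ → A) → A → ℝ} (hk : Ker k) {i n : ℕ} (hin : i < n)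
    {F : (ℕ → A) → A → ℝ} (hF : Dep i F) :
    S z n (fun y => pr k n y * F y (y i)) = S z i (fun y => pr k i y * ∑ a, k i y a * F y a) := by
  classical
  have hd : Dep (i+1) (fun y => F y (y i)) := by
    intro y y' h
    simp only
    rw [hF y y' (fun j hj => h j (by omega)), h i (by omega)]
  rw [S_pr_ext z hk hin hd, S_pr_succ z hk.dep]
  refine S_congr z fun y => ?_
  congr 1
  refine sum_congr rfl fun a _ => ?_
  rw [hF.upd le_rfl]; simp

/-- the core change-of-measure inequality -/
lemma core {I : Type} [Fintype I] [Nonempty I] (k q : I → ℕ → (ℕ → A) → A → ℝ)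
    (hk : ∀ w, Ker (k w)) (hq : ∀ w, Ker (q w)) (n : ℕ) (M : ℝ) (hM : 1 ≤ M)
    (G : I → (ℕ → A) → Prop)
    (hac : ∀ w y i, i < n → 0 < pr (k w) i y → 0 < k w i y (y i) → 0 < q w i y (y i))
    (hQ : ∑ w, S z n (fun y => pr (q w) n y * ind (G w y)) ≤ 2 * Fintype.card I / M) :
    (∑ w, S z n (fun y => pr (k w) n y * ind (G w y))) / Fintype.card I * Real.log M - Real.log 3
      ≤ (∑ w, ∑ i ∈ range n, S z i (fun y => pr (k w) i y *
          ∑ a, k w i y a * Real.log (k w i y a / q w i y a))) / Fintype.card I := by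
  have hc : (0:ℝ) < Fintype.card I := by exact_mod_cast Fintype.card_pos
  have hM0 : 0 < M := by linarith
  have key : ∀ w y, pr (k w) n y * ind (G w y) * Real.log M - Real.log 3 * pr (k w) n y
      - ∑ i ∈ range n, pr (k w) n y * Real.log (k w i y (y i) / q w i y (y i))
      ≤ (M/3) * (pr (q w) n y * ind (G w y)) + (1/3) * pr (q w) n y - pr (k w) n y := by
    intro w y
    have hp0 := pr_nonneg (hk w) n y
    have hq0 := pr_nonneg (hq w) n y
    have hi0 := ind_nonneg (G w y)
    rcases hp0.eq_or_lt with hp | hp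
    · rw [← hp]; simp; positivity
    · have hkpos : ∀ i < n, 0 < k w i y (y i) := by
        intro i hi
        refine lt_of_le_of_ne ((hk w).nn _ _ _) fun h => hp.ne' ?_
        exact prod_eq_zero (mem_range.2 hi) h.symm
      have hqpos : ∀ i < n, 0 < q w i y (y i) := fun i hi =>
        hac w y i hi (prod_pos fun j hj => hkpos j (by rw [mem_range] at hj; omega)) (hkpos i hi)
      have hqp : 0 < pr (q w) n y := prod_pos fun i hi => hqpos i (mem_range.1 hi)
      have hl : ∑ i ∈ range n, Real.log (k w i y (y i) / q w i y (y i))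
          = Real.log (pr (k w) n y) - Real.log (pr (q w) n y) := by
        rw [pr, pr, Real.log_prod (fun i hi => (hkpos i (mem_range.1 hi)).ne'),
          Real.log_prod (fun i hi => (hqpos i (mem_range.1 hi)).ne'), ← sum_sub_distrib]
        exact sum_congr rfl fun i hi => Real.log_div (hkpos i (mem_range.1 hi)).ne' (hqpos i (mem_range.1 hi)).ne'
      rw [← mul_sum, hl]
      set p := pr (k w) n y
      set r := pr (q w) n y
      have h1 := Real.log_le_sub_one_of_pos (x := (M * ind (G w y) + 1) * r / (3 * p)) (by positivity)
      rw [Real.log_div (by positivity) (by positivity), Real.log_mul (by positivity) (by positivity),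
        Real.log_mul (by positivity) (by positivity)] at h1
      have h2 : ind (G w y) * Real.log M ≤ Real.log (M * ind (G w y) + 1) := by
        rcases ind_cases (G w y) with h | h <;> rw [h]
        · simp
        · rw [one_mul, mul_one]; exact Real.log_le_log hM0 (by linarith)
      have h3 : ind (G w y) * Real.log M - Real.log 3 - (Real.log p - Real.log r)
          ≤ (M * ind (G w y) + 1) * r / (3 * p) - 1 := by linarith
      have h4 := mul_le_mul_of_nonneg_left h3 hp.le
      have h5 : p * ((M * ind (G w y) + 1) * r / (3 * p) - 1)
        = (M/3) * (r * ind (G w y)) + (1/3) * r - p := by field_simp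
      linarith
  have key2 : ∀ w, S z n (fun y => pr (k w) n y * ind (G w y)) * Real.log M - Real.log 3
      - ∑ i ∈ range n, S z i (fun y => pr (k w) i y *
          ∑ a, k w i y a * Real.log (k w i y a / q w i y a))
      ≤ (M/3) * S z n (fun y => pr (q w) n y * ind (G w y)) + 1/3 - 1 := by
    intro w
    have h := S_mono z (n := n) (key w)
    simp only [S_sub, S_add, S_mul, S_sum] at h
    rw [S_pr_one z (hk w), S_pr_one z (hq w)] at h
    have e1 : S z n (fun y => pr (k w) n y * ind (G w y) * Real.log M)
      = S z n (fun y => pr (k w) n y * ind (G w y)) * Real.log M := by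
      rw [mul_comm, ← S_mul]; exact S_congr z fun y => by ring
    have e2 : ∑ i ∈ range n, S z n (fun y => pr (k w) n y * Real.log (k w i y (y i) / q w i y (y i)))
      = ∑ i ∈ range n, S z i (fun y => pr (k w) i y *
          ∑ a, k w i y a * Real.log (k w i y a / q w i y a)) := by
      refine sum_congr rfl fun i hi => ?_
      refine S_pr_div z (hk w) (mem_range.1 hi) (F := fun y a => Real.log (k w i y a / q w i y a)) ?_
      intro y y' hy
      simp only
      rw [(hk w).dep i y y' hy, (hq w).dep i y y' hy]
    rw [e1, e2] at h
    linarith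
  have h := sum_le_sum (s := (univ : Finset I)) fun w _ => key2 w
  simp only [sum_sub_distrib, sum_add_distrib, ← sum_mul, ← mul_sum, sum_const, card_univ, nsmul_eq_mul] at h
  have h6 : (M/3) * ∑ w, S z n (fun y => pr (q w) n y * ind (G w y)) ≤ 2/3 * Fintype.card I := by
    have := mul_le_mul_of_nonneg_left hQ (show 0 ≤ M/3 by positivity)
    have e : M / 3 * (2 * Fintype.card I / M) = 2/3 * Fintype.card I := by field_simp
    linarith
  rw [div_mul_eq_mul_div, sub_le_iff_le_add, div_le_iff₀ hc, add_mul, div_mul_cancel₀ _ hc.ne']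
  linarith
end

section
variable {A : Type} [Fintype A] (z : A)

/-- stopped exactly at time `m` -/
def halt {A : Type} (a : ℕ → (ℕ → A) → Prop) (m : ℕ) (y : ℕ → A) : Prop :=
  ¬ a m y ∧ ∀ i < m, a i y

lemma halt_unique {a : ℕ → (ℕ → A) → Prop} {m m' : ℕ} {y : ℕ → A}
    (h : halt a m y) (h' : halt a m' y) : m = m' := by
  rcases lt_trichotomy m m' with hl | hl | hl
  · exact absurd (h'.2 m hl) h.1
  · exact hl
  · exact absurd (h.2 m' hl) h'.1

lemma halt_dep {a : ℕ → (ℕ → A) → Prop} (ha : ∀ i, Dep i (a i)) (m : ℕ) : Dep m (halt a m) := by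
  intro y y' h
  have h1 : ∀ i ≤ m, a i y = a i y' := fun i hi => ha i y y' fun j hj => h j (by omega)
  simp only [halt, eq_iff_iff]
  rw [h1 m le_rfl]
  refine and_congr_right fun _ => forall₂_congr fun i hi => ?_
  rw [h1 i hi.le]

lemma sum_ind (s : Finset ℕ) (p : ℕ → Prop) (hp : ∀ m m', p m → p m' → m = m') :
    ∑ m ∈ s, ind (p m) = ind (∃ m ∈ s, p m) := by
  by_cases h : ∃ m ∈ s, p m
  · rw [ind_true h]
    obtain ⟨m, hm, hpm⟩ := h
    rw [sum_eq_single m, ind_true hpm]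
    · intro b _ hb
      exact ind_false fun hpb => hb (hp _ _ hpb hpm)
    · intro h; exact absurd hm h
  · rw [ind_false h]
    refine sum_eq_zero fun m hm => ind_false fun hpm => h ⟨m, hm, hpm⟩

lemma sum_ind_eq {J : Type} [Fintype J] (j : J) (p : Prop) (c : Prop) :
    ∑ w, ind (p ∧ j = w ∧ c) = ind (p ∧ c) := by
  classical
  rw [sum_eq_single j]
  · simp
  · intro b _ hb; exact ind_false fun h => hb h.2.1.symm
  · simp

lemma QB {J : Type} [Fintype J] (q : J → ℕ → (ℕ → A) → A → ℝ) (hq : ∀ w, Ker (q w))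
    (v : ℕ → (ℕ → A) → A → ℝ) (hv : Ker v) (a : ℕ → (ℕ → A) → Prop) (ha : ∀ i, Dep i (a i))
    (hag : ∀ w i y, a i y → q w i y = v i y)
    (d : ℕ → (ℕ → A) → J) (hd : ∀ i, Dep i (d i))
    (c : ℕ → (ℕ → A) → Prop) (hc : ∀ i, Dep i (c i)) (n : ℕ) :
    ∑ w, S z n (fun y => pr (q w) n y * ind (∃ m ∈ range (n+1), halt a m y ∧ d m y = w ∧ c m y))
    = S z n (fun y => pr v n y * ind (∃ m ∈ range (n+1), halt a m y ∧ c m y)) := by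
  have e1 : ∀ w y, ind (∃ m ∈ range (n+1), halt a m y ∧ d m y = w ∧ c m y)
      = ∑ m ∈ range (n+1), ind (halt a m y ∧ d m y = w ∧ c m y) := fun w y =>
    (sum_ind _ _ fun m m' h h' => halt_unique h.1 h'.1).symm
  have e2 : ∀ y, ind (∃ m ∈ range (n+1), halt a m y ∧ c m y)
      = ∑ m ∈ range (n+1), ind (halt a m y ∧ c m y) := fun y =>
    (sum_ind _ _ fun m m' h h' => halt_unique h.1 h'.1).symm
  simp_rw [e1, e2, mul_sum, S_sum]
  rw [sum_comm]
  refine sum_congr rfl fun m hm => ?_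
  have hmn : m ≤ n := by rw [mem_range] at hm; omega
  have e3 : ∀ y, ind (halt a m y ∧ c m y) = ∑ w, ind (halt a m y ∧ d m y = w ∧ c m y) :=
    fun y => (sum_ind_eq _ _ _).symm
  simp_rw [e3, mul_sum, S_sum]
  refine sum_congr rfl fun w _ => ?_
  have hD : Dep m (fun y => ind (halt a m y ∧ d m y = w ∧ c m y)) := by
    intro y y' h
    simp only
    rw [halt_dep ha m y y' h, hd m y y' h, hc m y y' h]
  rw [S_pr_ext z (hq w) hmn hD, S_pr_ext z hv hmn hD]
  refine S_congr z fun y => ?_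
  by_cases hs : halt a m y
  · congr 1
    refine prod_congr rfl fun i hi => ?_
    rw [hag w i y (hs.2 i (mem_range.1 hi))]
  · rw [ind_false (fun h => hs h.1)]; simp

lemma S_pr_ind_le {v : ℕ → (ℕ → A) → A → ℝ} (hv : Ker v) (n : ℕ) (p : (ℕ → A) → Prop) :
    S z n (fun y => pr v n y * ind (p y)) ≤ 1 := by
  rw [← S_pr_one z hv n]
  exact S_mono z fun y => mul_le_of_le_one_right (pr_nonneg hv n y) (ind_le_one _)

/-- stopped by time `n` and decoded as `w` -/
def Good {A J : Type} (a : ℕ → (ℕ → A) → Prop) (d : ℕ → (ℕ → A) → J) (n : ℕ) (w : J)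
    (y : ℕ → A) : Prop := ∃ m ∈ range (n+1), halt a m y ∧ d m y = w

lemma QB1 {J : Type} [Fintype J] (q : J → ℕ → (ℕ → A) → A → ℝ) (hq : ∀ w, Ker (q w))
    (v : ℕ → (ℕ → A) → A → ℝ) (hv : Ker v) (a : ℕ → (ℕ → A) → Prop) (ha : ∀ i, Dep i (a i))
    (hag : ∀ w i y, a i y → q w i y = v i y)
    (d : ℕ → (ℕ → A) → J) (hd : ∀ i, Dep i (d i)) (n : ℕ) :
    ∑ w, S z n (fun y => pr (q w) n y * ind (Good a d n w y)) ≤ 1 := by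
  have h := QB z q hq v hv a ha hag d hd (fun _ _ => True) (fun _ _ _ _ => rfl) n
  simp only [and_true] at h
  unfold Good
  rw [h]
  exact S_pr_ind_le z hv n _

lemma Q12half {J K : Type} [Fintype J] [Fintype K] (q : J → K → ℕ → (ℕ → A) → A → ℝ)
    (hq : ∀ w w', Ker (q w w'))
    (v : K → ℕ → (ℕ → A) → A → ℝ) (hv : ∀ w, Ker (v w))
    (u : ℕ → (ℕ → A) → A → ℝ) (hu : Ker u)
    (a b : ℕ → (ℕ → A) → Prop) (ha : ∀ i, Dep i (a i)) (hb : ∀ i, Dep i (b i))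
    (hag : ∀ w w' i y, a i y → q w w' i y = v w' i y)
    (hag' : ∀ w' i y, b i y → v w' i y = u i y)
    (d : ℕ → (ℕ → A) → J) (hd : ∀ i, Dep i (d i))
    (e : ℕ → (ℕ → A) → K) (he : ∀ i, Dep i (e i)) (n : ℕ) :
    ∑ w, ∑ w', S z n (fun y => pr (q w w') n y * ind (∃ m ∈ range (n+1), halt a m y ∧ d m y = w ∧
      ∃ l ∈ range (m+1), halt b l y ∧ e l y = w')) ≤ 1 := by
  rw [sum_comm]
  refine le_trans (sum_le_sum fun w' _ => ?_) (QB1 z v hv u hu b hb hag' e he n)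
  rw [QB z (fun w => q w w') (fun w => hq w w') (v w') (hv w') a ha (fun w => hag w w') d hd
    (fun m y => ∃ l ∈ range (m+1), halt b l y ∧ e l y = w') ?_ n]
  · refine S_mono z fun y => mul_le_mul_of_nonneg_left (ind_mono ?_) (pr_nonneg (hv w') n y)
    rintro ⟨m, hm, -, l, hl, h⟩
    simp only [mem_range] at hm hl
    exact ⟨l, by simp only [mem_range]; omega, h⟩
  · intro m y y' h
    simp only [eq_iff_iff]
    refine exists_congr fun l => and_congr_right fun hl => ?_
    have h' : ∀ j < l, y j = y' j := fun j hj => h j (by rw [mem_range] at hl; omega)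
    rw [halt_dep hb l y y' h', he l y y' h']

lemma Q12 {J K : Type} [Fintype J] [Fintype K] (q : J → K → ℕ → (ℕ → A) → A → ℝ)
    (hq : ∀ w w', Ker (q w w'))
    (v1 : J → ℕ → (ℕ → A) → A → ℝ) (hv1 : ∀ w, Ker (v1 w))
    (v2 : K → ℕ → (ℕ → A) → A → ℝ) (hv2 : ∀ w, Ker (v2 w))
    (u : ℕ → (ℕ → A) → A → ℝ) (hu : Ker u)
    (a b : ℕ → (ℕ → A) → Prop) (ha : ∀ i, Dep i (a i)) (hb : ∀ i, Dep i (b i))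
    (hag1 : ∀ w w' i y, a i y → q w w' i y = v2 w' i y)
    (hag2 : ∀ w w' i y, b i y → q w w' i y = v1 w i y)
    (hag1' : ∀ w i y, a i y → v1 w i y = u i y)
    (hag2' : ∀ w' i y, b i y → v2 w' i y = u i y)
    (d : ℕ → (ℕ → A) → J) (hd : ∀ i, Dep i (d i))
    (e : ℕ → (ℕ → A) → K) (he : ∀ i, Dep i (e i)) (n : ℕ) :
    ∑ w, ∑ w', S z n (fun y => pr (q w w') n y * ind (Good a d n w y ∧ Good b e n w' y)) ≤ 2 := by
  have h1 := Q12half z q hq v2 hv2 u hu a b ha hb hag1 hag2' d hd e he n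
  have h2 := Q12half z (fun w' w => q w w') (fun w' w => hq w w') v1 hv1 u hu b a hb ha
    (fun w' w => hag2 w w') hag1' e he d hd n
  rw [sum_comm] at h2
  refine le_trans ?_ (show (1:ℝ) + 1 ≤ 2 by norm_num)
  refine le_trans ?_ (add_le_add h1 h2)
  rw [← sum_add_distrib]
  refine sum_le_sum fun w _ => ?_
  rw [← sum_add_distrib]
  refine sum_le_sum fun w' _ => ?_
  rw [← S_add]
  refine S_mono z fun y => ?_
  rw [← mul_add]
  refine mul_le_mul_of_nonneg_left ?_ (pr_nonneg (hq w w') n y)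
  by_cases hG : Good a d n w y ∧ Good b e n w' y
  · rw [ind_true hG]
    obtain ⟨⟨m, hm, hm1, hm2⟩, ⟨l, hl, hl1, hl2⟩⟩ := hG
    rcases le_total l m with hlm | hlm
    · have := ind_nonneg (∃ l ∈ range (n+1), halt b l y ∧ e l y = w' ∧
        ∃ m ∈ range (l+1), halt a m y ∧ d m y = w)
      rw [ind_true ⟨m, hm, hm1, hm2, l, by rw [mem_range]; omega, hl1, hl2⟩]
      linarith
    · have := ind_nonneg (∃ m ∈ range (n+1), halt a m y ∧ d m y = w ∧
        ∃ l ∈ range (m+1), halt b l y ∧ e l y = w')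
      have h3 := ind_true (p := ∃ l ∈ range (n+1), halt b l y ∧ e l y = w' ∧
        ∃ m ∈ range (l+1), halt a m y ∧ d m y = w) ⟨l, hl, hl1, hl2, m, by rw [mem_range]; omega, hm1, hm2⟩
      linarith
  · rw [ind_false hG]
    exact add_nonneg (ind_nonneg _) (ind_nonneg _)
end

section
variable {X1 X2 Y : Type} [Fintype X1] [Fintype X2] [Fintype Y]
  (ch : X1 → X2 → Y → ℝ)

lemma fbMI2_eq (π : X1 × X2 → ℝ) : fbMI2 ch π = fbMI1 (fun x2 x1 => ch x1 x2) (π ∘ Prod.swap) := by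
  unfold fbMI2 fbMI1; rw [sum_comm]; rfl

lemma Cap2_eq : Cap2 ch = Cap1 (fun x2 x1 => ch x1 x2) := by
  unfold Cap2 Cap1
  congr 1
  ext c
  simp only [Set.mem_ofPred_eq]
  have h : ∀ q1 q2, miNoQ2 ch q1 q2 = miNoQ1 (fun x2 x1 => ch x1 x2) q2 q1 := by
    intro q1 q2
    unfold miNoQ2 miNoQ1
    rw [sum_comm]
    refine sum_congr rfl fun x2 _ => sum_congr rfl fun x1 _ => sum_congr rfl fun y _ => ?_
    rw [mul_comm (q1 x1)]
  constructor
  · rintro ⟨q1, q2, h1, h2, h3⟩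
    exact ⟨q2, q1, h2, h1, by rw [h3, h]⟩
  · rintro ⟨q1, q2, h1, h2, h3⟩
    exact ⟨q2, q1, h2, h1, by rw [h3, h]⟩

/-- output kernel given `x2` -/
def V1 (occ : X1 × X2 → ℝ) (x2 : X2) (a : Y) : ℝ :=
  if ∑ x1, occ (x1, x2) = 0 then 1 / Fintype.card Y
  else (∑ x1, occ (x1, x2) * ch x1 x2 a) / ∑ x1, occ (x1, x2)

variable {ch} (h0 : ∀ x1 x2 y, 0 ≤ ch x1 x2 y) (h1 : ∀ x1 x2, ∑ y, ch x1 x2 y = 1)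
  {occ : X1 × X2 → ℝ} (ho : ∀ p, 0 ≤ occ p)
include h0 ho

lemma V1_nn (x2 : X2) (a : Y) : 0 ≤ V1 ch occ x2 a := by
  unfold V1
  split_ifs
  · positivity
  · exact div_nonneg (sum_nonneg fun _ _ => mul_nonneg (ho _) (h0 _ _ _)) (sum_nonneg fun _ _ => ho _)

include h1 in
lemma V1_sum [Nonempty Y] (x2 : X2) : ∑ a, V1 ch occ x2 a = 1 := by
  unfold V1
  split_ifs with h
  · simp
  · rw [← sum_div, sum_comm]
    simp_rw [← mul_sum, h1, mul_one]
    exact div_self h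

lemma occ_le (x1 : X1) (x2 : X2) : occ (x1, x2) ≤ ∑ x1, occ (x1, x2) :=
  single_le_sum (f := fun x1 => occ (x1, x2)) (fun _ _ => ho _) (mem_univ x1)

lemma occch_le (x1 : X1) (x2 : X2) (a : Y) :
    occ (x1, x2) * ch x1 x2 a ≤ ∑ x1, occ (x1, x2) * ch x1 x2 a :=
  single_le_sum (f := fun x1 => occ (x1, x2) * ch x1 x2 a)
    (fun _ _ => mul_nonneg (ho _) (h0 _ _ _)) (mem_univ x1)

lemma V1_pos (x1 : X1) (x2 : X2) (a : Y) (hp : 0 < occ (x1, x2)) (hc : 0 < ch x1 x2 a) :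
    0 < V1 ch occ x2 a := by
  have h2 := occ_le h0 ho x1 x2
  have h3 := occch_le h0 ho x1 x2 a
  have h4 := mul_pos hp hc
  unfold V1
  rw [if_neg (by linarith)]
  exact div_pos (by linarith) (by linarith)

lemma V1_mi : ∑ x1, ∑ x2, occ (x1, x2) * ∑ a, ch x1 x2 a * Real.log (ch x1 x2 a / V1 ch occ x2 a)
    = fbMI1 ch occ := by
  unfold fbMI1
  refine sum_congr rfl fun x1 _ => sum_congr rfl fun x2 _ => ?_
  rw [mul_sum]
  refine sum_congr rfl fun a _ => ?_
  rcases (ho (x1, x2)).eq_or_lt with h | h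
  · rw [← h]; simp
  · have h2 := occ_le h0 ho x1 x2
    unfold V1
    rw [if_neg (by linarith), mul_assoc]

omit ho in
omit h0 in
lemma fbMI1_smul (t : ℝ) (ht : t ≠ 0) : fbMI1 ch (fun p => t * occ p) = t * fbMI1 ch occ := by
  unfold fbMI1
  simp_rw [mul_assoc t, ← mul_sum]
  simp_rw [mul_div_mul_left _ _ ht]

omit ho in
lemma bdd1 : BddAbove {c : ℝ | ∃ q1 : X1 → ℝ, ∃ q2 : X2 → ℝ,
    IsPMF q1 ∧ IsPMF q2 ∧ c = miNoQ1 ch q1 q2} := by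
  refine ⟨∑ x1 : X1, ∑ x2 : X2, ∑ y : Y, ch x1 x2 y, ?_⟩
  rintro c ⟨q1, q2, hq1, hq2, rfl⟩
  unfold miNoQ1
  refine sum_le_sum fun x1 _ => sum_le_sum fun x2 _ => sum_le_sum fun y _ => ?_
  have hc := h0 x1 x2 y
  have hb := hq2.1 x2
  have hb1 : q2 x2 ≤ 1 := hq2.2 ▸ single_le_sum (f := q2) (fun _ _ => hq2.1 _) (mem_univ x2)
  rcases hc.eq_or_lt with h | h
  · rw [← h]; simp
  rcases (hq1.1 x1).eq_or_lt with h' | h'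
  · rw [← h']; simpa using hc
  have h2 : q1 x1 * ch x1 x2 y ≤ ∑ x1, q1 x1 * ch x1 x2 y :=
    single_le_sum (f := fun x1 => q1 x1 * ch x1 x2 y)
      (fun _ _ => mul_nonneg (hq1.1 _) (h0 _ _ _)) (mem_univ x1)
  have h3 := mul_pos h' h
  have h4 : Real.log (ch x1 x2 y / ∑ x1, q1 x1 * ch x1 x2 y) ≤ 1 / q1 x1 := by
    refine (Real.log_le_sub_one_of_pos (div_pos h (by linarith))).trans ?_
    have : ch x1 x2 y / ∑ x1, q1 x1 * ch x1 x2 y ≤ 1 / q1 x1 := by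
      rw [div_le_div_iff₀ (by linarith) h']; linarith
    linarith
  calc q1 x1 * q2 x2 * ch x1 x2 y * Real.log (ch x1 x2 y / ∑ x1, q1 x1 * ch x1 x2 y)
      ≤ q1 x1 * q2 x2 * ch x1 x2 y * (1 / q1 x1) :=
        mul_le_mul_of_nonneg_left h4 (by positivity)
    _ = q2 x2 * ch x1 x2 y := by field_simp
    _ ≤ ch x1 x2 y := mul_le_of_le_one_left hc hb1

lemma fbMI1_le : fbMI1 ch occ ≤ (∑ p, occ p) * Cap1 ch := by
  classical
  have hx : ∀ x2, ∑ x1, ∑ y, occ (x1, x2) * ch x1 x2 y *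
    Real.log (ch x1 x2 y /
      ((∑ x1', occ (x1', x2) * ch x1' x2 y) / (∑ x1', occ (x1', x2)))) ≤
      (∑ x1, occ (x1, x2)) * Cap1 ch := by
    intro x2
    set m := ∑ x1, occ (x1, x2) with hm
    have hm0 : 0 ≤ m := sum_nonneg fun _ _ => ho _
    rcases hm0.eq_or_lt with h | h
    · have : ∀ x1, occ (x1, x2) = 0 := fun x1 =>
        le_antisymm (h ▸ occ_le h0 ho x1 x2) (ho _)
      simp [this, ← h]
    · have hq : IsPMF (fun x1 => occ (x1, x2) / m) :=
        ⟨fun _ => div_nonneg (ho _) hm0, by rw [← sum_div]; exact div_self h.ne'⟩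
      have hδ : IsPMF (fun x : X2 => if x = x2 then (1:ℝ) else 0) :=
        ⟨fun _ => by dsimp only; split_ifs <;> norm_num, by simp⟩
      have hle : miNoQ1 ch (fun x1 => occ (x1, x2) / m) (fun x : X2 => if x = x2 then (1:ℝ) else 0) ≤ Cap1 ch :=
        le_csSup (bdd1 h0) ⟨_, _, hq, hδ, rfl⟩
      refine le_trans (le_of_eq ?_) (mul_le_mul_of_nonneg_left hle hm0)
      unfold miNoQ1
      rw [mul_sum]
      refine sum_congr rfl fun x1 _ => ?_
      rw [sum_eq_single x2 (by intro b _ hb; simp [hb]) (by simp), mul_sum]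
      refine sum_congr rfl fun y _ => ?_
      simp only [if_true, mul_one]
      simp_rw [div_mul_eq_mul_div, ← sum_div]
      field_simp
  unfold fbMI1
  rw [sum_comm, Fintype.sum_prod_type_right, sum_mul]
  exact sum_le_sum fun x2 _ => hx x2

omit ho h0 in
lemma pair_le {π : X1 × X2 → ℝ} (h0 : ∀ x1 x2 y, 0 ≤ ch x1 x2 y) (ho : ∀ p, 0 ≤ π p)
    (x1 : X1) (x2 : X2) (y : Y) :
    π (x1, x2) * ch x1 x2 y ≤ ∑ x1', ∑ x2', π (x1', x2') * ch x1' x2' y := by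
  have := single_le_sum (f := fun p : X1 × X2 => π p * ch p.1 p.2 y)
    (fun _ _ => mul_nonneg (ho _) (h0 _ _ _)) (mem_univ (x1, x2))
  rwa [Fintype.sum_prod_type] at this

include h1 in
lemma fbMI1_formula : fbMI1 ch occ = ∑ x1, ∑ x2, ∑ y, occ (x1, x2) * (ch x1 x2 y * Real.log (ch x1 x2 y))
    - ∑ x2, ∑ y, (∑ x1, occ (x1, x2) * ch x1 x2 y) * Real.log (∑ x1, occ (x1, x2) * ch x1 x2 y)
    + ∑ x2, (∑ x1, occ (x1, x2)) * Real.log (∑ x1, occ (x1, x2)) := by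
  have e1 : ∀ x2, ∑ y, (∑ x1, occ (x1, x2) * ch x1 x2 y) * Real.log (∑ x1, occ (x1, x2) * ch x1 x2 y)
      = ∑ x1, ∑ y, occ (x1, x2) * ch x1 x2 y * Real.log (∑ x1, occ (x1, x2) * ch x1 x2 y) := by
    intro x2
    rw [sum_comm]
    simp_rw [sum_mul]
  have e2 : ∀ x2, (∑ x1, occ (x1, x2)) * Real.log (∑ x1, occ (x1, x2))
      = ∑ x1, ∑ y, occ (x1, x2) * ch x1 x2 y * Real.log (∑ x1, occ (x1, x2)) := by
    intro x2
    simp_rw [← sum_mul, ← mul_sum, h1, mul_one]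
  simp_rw [e1, e2]
  unfold fbMI1
  rw [sum_comm, sum_comm (f := fun x1 x2 => ∑ y, occ (x1, x2) * (ch x1 x2 y * Real.log (ch x1 x2 y)))]
  simp_rw [← sum_sub_distrib, ← sum_add_distrib]
  refine sum_congr rfl fun x2 _ => sum_congr rfl fun x1 _ => sum_congr rfl fun y _ => ?_
  rcases (ho (x1, x2)).eq_or_lt with h | h
  · rw [← h]; simp
  rcases (h0 x1 x2 y).eq_or_lt with h' | h'
  · rw [← h']; simp
  have h2 := occ_le h0 ho x1 x2
  have h3 := occch_le h0 ho x1 x2 y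
  have h4 := mul_pos h h'
  have h5 : 0 < ∑ x1, occ (x1, x2) := by linarith
  have h6 : 0 < ∑ x1, occ (x1, x2) * ch x1 x2 y := by linarith
  rw [Real.log_div h'.ne' (div_pos h6 h5).ne', Real.log_div h6.ne' h5.ne']
  ring

lemma fbMI12_formula : fbMI12 ch occ = ∑ x1, ∑ x2, ∑ y, occ (x1, x2) * (ch x1 x2 y * Real.log (ch x1 x2 y))
    - ∑ y, (∑ x1, ∑ x2, occ (x1, x2) * ch x1 x2 y) * Real.log (∑ x1, ∑ x2, occ (x1, x2) * ch x1 x2 y) := by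
  have e1 : ∑ y, (∑ x1, ∑ x2, occ (x1, x2) * ch x1 x2 y) * Real.log (∑ x1, ∑ x2, occ (x1, x2) * ch x1 x2 y)
      = ∑ x1, ∑ x2, ∑ y, occ (x1, x2) * ch x1 x2 y * Real.log (∑ x1, ∑ x2, occ (x1, x2) * ch x1 x2 y) := by
    simp_rw [sum_mul]
    rw [sum_comm]
    refine sum_congr rfl fun x1 _ => ?_
    rw [sum_comm]
  rw [e1]
  unfold fbMI12
  simp_rw [← sum_sub_distrib]
  refine sum_congr rfl fun x1 _ => sum_congr rfl fun x2 _ => sum_congr rfl fun y _ => ?_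
  rcases (ho (x1, x2)).eq_or_lt with h | h
  · rw [← h]; simp
  rcases (h0 x1 x2 y).eq_or_lt with h' | h'
  · rw [← h']; simp
  have h3 := pair_le h0 ho x1 x2 y
  have h4 := mul_pos h h'
  rw [Real.log_div h'.ne' (by linarith)]
  ring

omit ho
include h1

lemma cont1 : ContinuousOn (fun π : X1 × X2 → ℝ => fbMI1 ch π) {π | ∀ p, 0 ≤ π p} := by
  have hA : Continuous (fun occ : X1 × X2 → ℝ => ∑ x1, ∑ x2, ∑ y, occ (x1, x2) * (ch x1 x2 y * Real.log (ch x1 x2 y))) :=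
    continuous_finsetSum _ fun x1 _ => continuous_finsetSum _ fun x2 _ =>
      continuous_finsetSum _ fun y _ => (continuous_apply (x1, x2)).mul continuous_const
  have hB : Continuous (fun occ : X1 × X2 → ℝ => ∑ x2, ∑ y, (∑ x1, occ (x1, x2) * ch x1 x2 y) * Real.log (∑ x1, occ (x1, x2) * ch x1 x2 y)) := by
    refine continuous_finsetSum _ fun x2 _ => continuous_finsetSum _ fun y _ => ?_
    have hc : Continuous (fun occ : X1 × X2 → ℝ => ∑ x1, occ (x1, x2) * ch x1 x2 y) :=
      continuous_finsetSum _ fun x1 _ => (continuous_apply (x1, x2)).mul continuous_const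
    exact Real.continuous_mul_log.comp hc
  have hC : Continuous (fun occ : X1 × X2 → ℝ => ∑ x2, (∑ x1, occ (x1, x2)) * Real.log (∑ x1, occ (x1, x2))) := by
    refine continuous_finsetSum _ fun x2 _ => ?_
    have hc : Continuous (fun occ : X1 × X2 → ℝ => ∑ x1, occ (x1, x2)) :=
      continuous_finsetSum _ fun x1 _ => continuous_apply (x1, x2)
    exact Real.continuous_mul_log.comp hc
  have hD := ((hA.sub hB).add hC).continuousOn (s := {π | ∀ p, 0 ≤ π p})
  refine hD.congr ?_
  intro π hπ
  have hπ' : ∀ p, 0 ≤ π p := by simpa using hπ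
  exact fbMI1_formula h0 h1 hπ'

omit h1 in
lemma cont12 : ContinuousOn (fun π : X1 × X2 → ℝ => fbMI12 ch π) {π | ∀ p, 0 ≤ π p} := by
  have hA : Continuous (fun occ : X1 × X2 → ℝ => ∑ x1, ∑ x2, ∑ y, occ (x1, x2) * (ch x1 x2 y * Real.log (ch x1 x2 y))) :=
    continuous_finsetSum _ fun x1 _ => continuous_finsetSum _ fun x2 _ =>
      continuous_finsetSum _ fun y _ => (continuous_apply (x1, x2)).mul continuous_const
  have hB : Continuous (fun occ : X1 × X2 → ℝ => ∑ y, (∑ x1, ∑ x2, occ (x1, x2) * ch x1 x2 y) * Real.log (∑ x1, ∑ x2, occ (x1, x2) * ch x1 x2 y)) := by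
    refine continuous_finsetSum _ fun y _ => ?_
    have hc : Continuous (fun occ : X1 × X2 → ℝ => ∑ x1, ∑ x2, occ (x1, x2) * ch x1 x2 y) :=
      continuous_finsetSum _ fun x1 _ => continuous_finsetSum _ fun x2 _ =>
        (continuous_apply (x1, x2)).mul continuous_const
    exact Real.continuous_mul_log.comp hc
  have hD := (hA.sub hB).continuousOn (s := {π | ∀ p, 0 ≤ π p})
  refine hD.congr ?_
  intro π hπ
  have hπ' : ∀ p, 0 ≤ π p := by simpa using hπ
  exact fbMI12_formula h0 hπ'

lemma cont2 : ContinuousOn (fun π : X1 × X2 → ℝ => fbMI2 ch π) {π | ∀ p, 0 ≤ π p} := by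
  simp_rw [fbMI2_eq]
  refine (cont1 (ch := fun x2 x1 => ch x1 x2) (fun a b y => h0 b a y) (fun a b => h1 b a)).comp
    (f := fun π : X1 × X2 → ℝ => π ∘ Prod.swap) ?_ ?_
  · apply Continuous.continuousOn
    exact continuous_pi fun p => continuous_apply (A := fun _ => ℝ) (Prod.swap p)
  · intro π hπ p; exact hπ _
end

section
variable {X1 X2 Y : Type} [Fintype X1] [Fintype X2] [Fintype Y]

/-- channel kernel of a feedback code -/
def kk {I X1 X2 Y : Type} (ch : X1 → X2 → Y → ℝ) (x1 : I → ℕ → (ℕ → Y) → X1)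
    (x2 : I → ℕ → (ℕ → Y) → X2) (w : I) (i : ℕ) (y : ℕ → Y) (a : Y) : ℝ :=
  ch (x1 w i y) (x2 w i y) a

/-- expected number of times `i < n` with `B i` -/
def T {I : Type} [Fintype I] (z : Y) (k : I → ℕ → (ℕ → Y) → Y → ℝ) (n : ℕ)
    (B : ℕ → (ℕ → Y) → Prop) : ℝ :=
  (∑ w, ∑ i ∈ range n, S z i (fun y => pr (k w) i y * ind (B i y))) / Fintype.card I

/-- occupation measure -/
def occ {I : Type} [Fintype I] (ch : X1 → X2 → Y → ℝ) (x1 : I → ℕ → (ℕ → Y) → X1)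
    (x2 : I → ℕ → (ℕ → Y) → X2) (z : Y) (n : ℕ) (B : ℕ → (ℕ → Y) → Prop) (p : X1 × X2) : ℝ :=
  (∑ w, ∑ i ∈ range n, S z i (fun y => pr (kk ch x1 x2 w) i y *
    ind (B i y ∧ x1 w i y = p.1 ∧ x2 w i y = p.2))) / Fintype.card I

open Classical in
/-- comparison kernel -/
def qk {I : Type} (ch R0 R1 R2 : X1 → X2 → Y → ℝ) (x1 : I → ℕ → (ℕ → Y) → X1)
    (x2 : I → ℕ → (ℕ → Y) → X2) (a1 a2 : ℕ → (ℕ → Y) → Prop) (w : I) (i : ℕ) (y : ℕ → Y)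
    (a : Y) : ℝ :=
  if a1 i y then (if a2 i y then R0 (x1 w i y) (x2 w i y) a else R1 (x1 w i y) (x2 w i y) a)
  else (if a2 i y then R2 (x1 w i y) (x2 w i y) a else ch (x1 w i y) (x2 w i y) a)

/-- stochastic matrices -/
structure Stoch {X1 X2 Y : Type} [Fintype Y] (ch : X1 → X2 → Y → ℝ) : Prop where
  nn : ∀ x1 x2 y, 0 ≤ ch x1 x2 y
  one : ∀ x1 x2, ∑ y, ch x1 x2 y = 1

variable {I : Type} [Fintype I] [Nonempty I] {ch : X1 → X2 → Y → ℝ} (hch : Stoch ch)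
  {x1 : I → ℕ → (ℕ → Y) → X1} {x2 : I → ℕ → (ℕ → Y) → X2}
  (hx1 : ∀ w i, Dep i (x1 w i)) (hx2 : ∀ w i, Dep i (x2 w i)) (z : Y)

include hch hx1 hx2

lemma kk_ker (w : I) : Ker (kk ch x1 x2 w) where
  dep i y y' h := by
    funext a; unfold kk; rw [hx1 w i y y' h, hx2 w i y y' h]
  nn _ _ _ := hch.nn _ _ _
  one _ _ := hch.one _ _

lemma qk_ker {R0 R1 R2 : X1 → X2 → Y → ℝ} (h0 : Stoch R0) (h1 : Stoch R1) (h2 : Stoch R2)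
    {a1 a2 : ℕ → (ℕ → Y) → Prop} (ha1 : ∀ i, Dep i (a1 i)) (ha2 : ∀ i, Dep i (a2 i)) (w : I) :
    Ker (qk ch R0 R1 R2 x1 x2 a1 a2 w) where
  dep i y y' h := by
    have e1 : a1 i y ↔ a1 i y' := (ha1 i y y' h).to_iff
    have e2 : a2 i y ↔ a2 i y' := (ha2 i y y' h).to_iff
    funext a; unfold qk
    rw [hx1 w i y y' h, hx2 w i y y' h]
    by_cases h1 : a1 i y' <;> by_cases h2 : a2 i y' <;> simp [e1, e2, h1, h2]
  nn _ _ _ := by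
    unfold qk; split_ifs
    exacts [h0.nn _ _ _, h1.nn _ _ _, h2.nn _ _ _, hch.nn _ _ _]
  one _ _ := by
    unfold qk; split_ifs
    exacts [h0.one _ _, h1.one _ _, h2.one _ _, hch.one _ _]

lemma occ_nn (n : ℕ) (B : ℕ → (ℕ → Y) → Prop) (p : X1 × X2) : 0 ≤ occ ch x1 x2 z n B p :=
  div_nonneg (sum_nonneg fun w _ => sum_nonneg fun _ _ => S_nonneg z fun _ =>
    mul_nonneg (pr_nonneg (kk_ker hch hx1 hx2 w) _ _) (ind_nonneg _)) (Nat.cast_nonneg _)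

lemma occ_pos (n : ℕ) (B : ℕ → (ℕ → Y) → Prop) (hB : ∀ i, Dep i (B i)) (w : I) (i : ℕ) (hi : i < n)
    (y : ℕ → Y) (hp : 0 < pr (kk ch x1 x2 w) i y) (hb : B i y) :
    0 < occ ch x1 x2 z n B (x1 w i y, x2 w i y) := by
  refine div_pos ?_ (by exact_mod_cast Fintype.card_pos)
  have hnn : ∀ w' i', 0 ≤ S z i' (fun y' => pr (kk ch x1 x2 w') i' y' *
    ind (B i' y' ∧ x1 w' i' y' = x1 w i y ∧ x2 w' i' y' = x2 w i y)) := fun w' i' =>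
    S_nonneg z fun _ => mul_nonneg (pr_nonneg (kk_ker hch hx1 hx2 w') _ _) (ind_nonneg _)
  refine lt_of_lt_of_le ?_ (single_le_sum (fun w' _ => sum_nonneg fun i' _ => hnn w' i') (mem_univ w))
  refine lt_of_lt_of_le ?_ (single_le_sum (fun i' _ => hnn w i') (mem_range.2 hi))
  refine lt_of_lt_of_le ?_ (S_single z (fun _ => mul_nonneg (pr_nonneg (kk_ker hch hx1 hx2 w) _ _) (ind_nonneg _)) ?_ y)
  · rw [ind_true ⟨hb, rfl, rfl⟩]; linarith
  · intro y y' h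
    simp only
    rw [pr_dep (kk_ker hch hx1 hx2 w).dep i y y' h, hB i y y' h, hx1 w i y y' h, hx2 w i y y' h]

omit [Nonempty I] hch hx1 hx2 in
lemma occ_sum (n : ℕ) (B : ℕ → (ℕ → Y) → Prop) (D : X1 → X2 → ℝ) :
    (∑ w, ∑ i ∈ range n, S z i (fun y => pr (kk ch x1 x2 w) i y *
      (ind (B i y) * D (x1 w i y) (x2 w i y)))) / Fintype.card I
    = ∑ p1, ∑ p2, occ ch x1 x2 z n B (p1, p2) * D p1 p2 := by
  classical
  have e : ∀ w i y, ind (B i y) * D (x1 w i y) (x2 w i y) =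
      ∑ p : X1 × X2, D p.1 p.2 * ind (B i y ∧ x1 w i y = p.1 ∧ x2 w i y = p.2) := by
    intro w i y
    rw [sum_eq_single (x1 w i y, x2 w i y)]
    · simp only [and_true]; ring
    · rintro ⟨p1, p2⟩ _ hb
      rw [ind_false, mul_zero]
      rintro ⟨-, h1, h2⟩
      exact hb (by simp only at h1 h2; rw [h1, h2])
    · simp
  rw [← Fintype.sum_prod_type (f := fun p : X1 × X2 => occ ch x1 x2 z n B (p.1, p.2) * D p.1 p.2)]
  simp_rw [e, mul_sum, S_sum]
  have e2 : ∀ w i (p : X1 × X2), S z i (fun y => pr (kk ch x1 x2 w) i y *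
      (D p.1 p.2 * ind (B i y ∧ x1 w i y = p.1 ∧ x2 w i y = p.2))) =
      D p.1 p.2 * S z i (fun y => pr (kk ch x1 x2 w) i y *
      (ind (B i y ∧ x1 w i y = p.1 ∧ x2 w i y = p.2))) := by
    intro w i p
    rw [← S_mul]; exact S_congr z fun y => by ring
  simp_rw [e2]
  have e3 : ∀ w : I, ∑ i ∈ range n, ∑ p : X1 × X2, D p.1 p.2 * S z i (fun y => pr (kk ch x1 x2 w) i y *
      (ind (B i y ∧ x1 w i y = p.1 ∧ x2 w i y = p.2))) = ∑ p : X1 × X2, ∑ i ∈ range n, D p.1 p.2 * S z i (fun y => pr (kk ch x1 x2 w) i y *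
      (ind (B i y ∧ x1 w i y = p.1 ∧ x2 w i y = p.2))) := fun w => sum_comm
  simp_rw [e3]
  rw [sum_comm, sum_div]
  refine sum_congr rfl fun p _ => ?_
  simp_rw [← mul_sum]
  unfold occ
  ring

omit [Nonempty I] hch hx1 hx2 in
lemma occ_tot (n : ℕ) (B : ℕ → (ℕ → Y) → Prop) :
    ∑ p, occ ch x1 x2 z n B p = T z (kk ch x1 x2) n B := by
  have := occ_sum (ch := ch) (x1 := x1) (x2 := x2) z n B (fun _ _ => 1)
  simp only [mul_one] at this
  rw [Fintype.sum_prod_type, ← this]; rfl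

/-- divergence sum -/
def dv (ch R : X1 → X2 → Y → ℝ) (p1 : X1) (p2 : X2) : ℝ :=
  ∑ a, ch p1 p2 a * Real.log (ch p1 p2 a / R p1 p2 a)

lemma core_phase {R0 R1 R2 : X1 → X2 → Y → ℝ} (h0 : Stoch R0) (h1 : Stoch R1) (h2 : Stoch R2)
    {a1 a2 : ℕ → (ℕ → Y) → Prop} (ha1 : ∀ i, Dep i (a1 i)) (ha2 : ∀ i, Dep i (a2 i)) (n : ℕ)
    (hp0 : ∀ p1 p2 a, 0 < occ ch x1 x2 z n (fun i y => a1 i y ∧ a2 i y) (p1, p2) → 0 < ch p1 p2 a →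
      0 < R0 p1 p2 a)
    (hp1 : ∀ p1 p2 a, 0 < occ ch x1 x2 z n (fun i y => a1 i y ∧ ¬ a2 i y) (p1, p2) → 0 < ch p1 p2 a →
      0 < R1 p1 p2 a)
    (hp2 : ∀ p1 p2 a, 0 < occ ch x1 x2 z n (fun i y => ¬ a1 i y ∧ a2 i y) (p1, p2) → 0 < ch p1 p2 a →
      0 < R2 p1 p2 a)
    (M : ℝ) (hM : 1 ≤ M) (G : I → (ℕ → Y) → Prop)
    (hQ : ∑ w, S z n (fun y => pr (qk ch R0 R1 R2 x1 x2 a1 a2 w) n y * ind (G w y))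
      ≤ 2 * Fintype.card I / M) :
    (∑ w, S z n (fun y => pr (kk ch x1 x2 w) n y * ind (G w y))) / Fintype.card I * Real.log M - Real.log 3
      ≤ ∑ p1, ∑ p2, occ ch x1 x2 z n (fun i y => a1 i y ∧ a2 i y) (p1, p2) * dv ch R0 p1 p2
      + ∑ p1, ∑ p2, occ ch x1 x2 z n (fun i y => a1 i y ∧ ¬ a2 i y) (p1, p2) * dv ch R1 p1 p2
      + ∑ p1, ∑ p2, occ ch x1 x2 z n (fun i y => ¬ a1 i y ∧ a2 i y) (p1, p2) * dv ch R2 p1 p2 := by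
  have hd : ∀ (i : ℕ) (y y' : ℕ → Y), (∀ j < i, y j = y' j) → a1 i y = a1 i y' ∧ a2 i y = a2 i y' :=
    fun i y y' h => ⟨ha1 i y y' h, ha2 i y y' h⟩
  have key := core z (kk ch x1 x2) (qk ch R0 R1 R2 x1 x2 a1 a2) (kk_ker hch hx1 hx2)
    (qk_ker hch hx1 hx2 h0 h1 h2 ha1 ha2) n M hM G ?_ hQ
  · refine key.trans (le_of_eq ?_)
    rw [← occ_sum, ← occ_sum, ← occ_sum, ← add_div, ← add_div]
    simp_rw [← sum_add_distrib, ← S_add]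
    congr 1
    refine sum_congr rfl fun w _ => sum_congr rfl fun i _ => S_congr z fun y => ?_
    rw [← mul_add, ← mul_add]
    congr 1
    by_cases hb1 : a1 i y <;> by_cases hb2 : a2 i y <;> simp [qk, kk, dv, ind, hb1, hb2]
  · intro w y i hi hp hk
    unfold qk
    split_ifs with hb1 hb2 hb2
    · refine hp0 _ _ _ (occ_pos hch hx1 hx2 z n _ ?_ w i hi y hp ⟨hb1, hb2⟩) hk
      intro i y y' h; simp only; rw [(hd i y y' h).1, (hd i y y' h).2]
    · refine hp1 _ _ _ (occ_pos hch hx1 hx2 z n _ ?_ w i hi y hp ⟨hb1, hb2⟩) hk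
      intro i y y' h; simp only; rw [(hd i y y' h).1, (hd i y y' h).2]
    · refine hp2 _ _ _ (occ_pos hch hx1 hx2 z n _ ?_ w i hi y hp ⟨hb1, hb2⟩) hk
      intro i y y' h; simp only; rw [(hd i y y' h).1, (hd i y y' h).2]
    · exact hk
end

section
variable {X1 X2 Y : Type} [Fintype X1] [Fintype X2] [Fintype Y]

lemma stochV1 [Nonempty Y] {ch : X1 → X2 → Y → ℝ} (hch : Stoch ch) {o : X1 × X2 → ℝ} (ho : ∀ p, 0 ≤ o p) :
    Stoch (fun (_ : X1) p2 => V1 ch o p2) :=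
  ⟨fun _ _ _ => V1_nn hch.nn ho _ _, fun _ _ => V1_sum hch.nn hch.one ho _⟩

/-- output kernel given `x1` -/
def V2 (ch : X1 → X2 → Y → ℝ) (o : X1 × X2 → ℝ) : X1 → Y → ℝ :=
  V1 (fun x2 x1 => ch x1 x2) (o ∘ Prod.swap)

lemma stochV2 [Nonempty Y] {ch : X1 → X2 → Y → ℝ} (hch : Stoch ch) {o : X1 × X2 → ℝ} (ho : ∀ p, 0 ≤ o p) :
    Stoch (fun p1 (_ : X2) => V2 ch o p1) :=
  ⟨fun _ _ _ => V1_nn (ch := fun x2 x1 => ch x1 x2) (occ := o ∘ Prod.swap) (fun _ _ _ => hch.nn _ _ _) (fun _ => ho _) _ _,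
    fun _ _ => V1_sum (ch := fun x2 x1 => ch x1 x2) (occ := o ∘ Prod.swap) (fun _ _ _ => hch.nn _ _ _) (fun _ _ => hch.one _ _) (fun _ => ho _) _⟩

lemma V2_pos {ch : X1 → X2 → Y → ℝ} (hch : Stoch ch) {o : X1 × X2 → ℝ} (ho : ∀ p, 0 ≤ o p)
    (x1 : X1) (x2 : X2) (a : Y) (hp : 0 < o (x1, x2)) (hc : 0 < ch x1 x2 a) : 0 < V2 ch o x1 a :=
  V1_pos (ch := fun x2 x1 => ch x1 x2) (occ := o ∘ Prod.swap) (fun _ _ _ => hch.nn _ _ _) (fun _ => ho _) x2 x1 a hp hc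

lemma V1_dv {ch : X1 → X2 → Y → ℝ} (hch : Stoch ch) {o : X1 × X2 → ℝ} (ho : ∀ p, 0 ≤ o p) :
    ∑ p1, ∑ p2, o (p1, p2) * dv ch (fun (_ : X1) p2 => V1 ch o p2) p1 p2 = fbMI1 ch o :=
  V1_mi hch.nn ho

lemma V2_dv {ch : X1 → X2 → Y → ℝ} (hch : Stoch ch) {o : X1 × X2 → ℝ} (ho : ∀ p, 0 ≤ o p) :
    ∑ p1, ∑ p2, o (p1, p2) * dv ch (fun p1 (_ : X2) => V2 ch o p1) p1 p2 = fbMI2 ch o := by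
  rw [fbMI2_eq, ← V1_mi (ch := fun x2 x1 => ch x1 x2) (occ := o ∘ Prod.swap) (fun _ _ _ => hch.nn _ _ _) (fun _ => ho _), sum_comm]
  rfl

lemma dv_self (ch : X1 → X2 → Y → ℝ) (p1 : X1) (p2 : X2) : dv ch ch p1 p2 = 0 := by
  unfold dv
  simp

lemma fbMI2_le {ch : X1 → X2 → Y → ℝ} (hch : Stoch ch) {o : X1 × X2 → ℝ} (ho : ∀ p, 0 ≤ o p) :
    fbMI2 ch o ≤ (∑ p, o p) * Cap2 ch := by
  rw [fbMI2_eq, Cap2_eq]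
  have := fbMI1_le (ch := fun x2 x1 => ch x1 x2) (occ := o ∘ Prod.swap)
    (fun _ _ _ => hch.nn _ _ _) (fun _ => ho _)
  have e : ∑ p, (o ∘ Prod.swap) p = ∑ p, o p := (Equiv.prodComm X2 X1).sum_comp o
  rwa [e] at this

lemma fbMI2_smul {ch : X1 → X2 → Y → ℝ} {o : X1 × X2 → ℝ} (t : ℝ) (ht : t ≠ 0) :
    fbMI2 ch (fun p => t * o p) = t * fbMI2 ch o := by
  rw [fbMI2_eq, fbMI2_eq]
  exact fbMI1_smul t ht

variable {J1 J2 : Type} [Fintype J1] [Fintype J2] [Nonempty J1] [Nonempty J2]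

lemma fin_bounds {ch : X1 → X2 → Y → ℝ} (hch : Stoch ch)
    {e1 : J1 → ℕ → (ℕ → Y) → X1} {e2 : J2 → ℕ → (ℕ → Y) → X2}
    (he1 : ∀ w i, Dep i (e1 w i)) (he2 : ∀ w i, Dep i (e2 w i)) (z : Y)
    {a1 a2 : ℕ → (ℕ → Y) → Prop} (ha1 : ∀ i, Dep i (a1 i)) (ha2 : ∀ i, Dep i (a2 i))
    (d1 : ℕ → (ℕ → Y) → J1) (hd1 : ∀ i, Dep i (d1 i))
    (d2 : ℕ → (ℕ → Y) → J2) (hd2 : ∀ i, Dep i (d2 i)) (n : ℕ)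
    (k : J1 × J2 → ℕ → (ℕ → Y) → Y → ℝ)
    (hk : k = kk ch (fun w => e1 w.1) (fun w => e2 w.2))
    (htot : 0 < T z k n (fun i y => a1 i y ∧ a2 i y)) :
    ∃ π : X1 × X2 → ℝ, IsPMF π ∧
      (∑ w, S z n (fun y => pr (k w) n y * ind (Good a1 d1 n w.1 y))) / Fintype.card (J1 × J2)
        * Real.log (Fintype.card J1) - Real.log 3
        ≤ T z k n (fun i y => a1 i y ∧ a2 i y) * fbMI1 ch π
          + T z k n (fun i y => a1 i y ∧ ¬ a2 i y) * Cap1 ch ∧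
      (∑ w, S z n (fun y => pr (k w) n y * ind (Good a2 d2 n w.2 y))) / Fintype.card (J1 × J2)
        * Real.log (Fintype.card J2) - Real.log 3
        ≤ T z k n (fun i y => a1 i y ∧ a2 i y) * fbMI2 ch π
          + T z k n (fun i y => ¬ a1 i y ∧ a2 i y) * Cap2 ch ∧
      (∑ w, S z n (fun y => pr (k w) n y * ind (Good a1 d1 n w.1 y ∧ Good a2 d2 n w.2 y)))
        / Fintype.card (J1 × J2)
        * Real.log (Fintype.card J1 * Fintype.card J2) - Real.log 3
        ≤ T z k n (fun i y => a1 i y ∧ a2 i y) * fbMI12 ch π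
          + T z k n (fun i y => a1 i y ∧ ¬ a2 i y) * Cap1 ch
          + T z k n (fun i y => ¬ a1 i y ∧ a2 i y) * Cap2 ch := by
  subst hk
  haveI : Nonempty Y := ⟨z⟩
  set x1 : J1 × J2 → ℕ → (ℕ → Y) → X1 := fun w => e1 w.1 with hx1e
  set x2 : J1 × J2 → ℕ → (ℕ → Y) → X2 := fun w => e2 w.2 with hx2e
  have hx1 : ∀ w i, Dep i (x1 w i) := fun w i => he1 w.1 i
  have hx2 : ∀ w i, Dep i (x2 w i) := fun w i => he2 w.2 i
  set o0 := occ ch x1 x2 z n (fun i y => a1 i y ∧ a2 i y) with ho0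
  set o1 := occ ch x1 x2 z n (fun i y => a1 i y ∧ ¬ a2 i y) with ho1
  set o2 := occ ch x1 x2 z n (fun i y => ¬ a1 i y ∧ a2 i y) with ho2
  have n0 : ∀ p, 0 ≤ o0 p := occ_nn hch hx1 hx2 z n _
  have n1 : ∀ p, 0 ≤ o1 p := occ_nn hch hx1 hx2 z n _
  have n2 : ∀ p, 0 ≤ o2 p := occ_nn hch hx1 hx2 z n _
  have t0 : ∑ p, o0 p = T z (kk ch x1 x2) n (fun i y => a1 i y ∧ a2 i y) := occ_tot z n _
  have t1 : ∑ p, o1 p = T z (kk ch x1 x2) n (fun i y => a1 i y ∧ ¬ a2 i y) := occ_tot z n _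
  have t2 : ∑ p, o2 p = T z (kk ch x1 x2) n (fun i y => ¬ a1 i y ∧ a2 i y) := occ_tot z n _
  set t := T z (kk ch x1 x2) n (fun i y => a1 i y ∧ a2 i y) with ht
  set π : X1 × X2 → ℝ := fun p => o0 p / t with hπ
  have hπ1 : IsPMF π := ⟨fun p => div_nonneg (n0 p) htot.le, by
    rw [hπ, ← sum_div, t0]; exact div_self htot.ne'⟩
  have hoπ : o0 = fun p => t * π p := by
    funext p; simp only [hπ]; field_simp
  have c1 : (1:ℝ) ≤ Fintype.card J1 := by exact_mod_cast (Fintype.card_pos : 0 < Fintype.card J1)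
  have c2 : (1:ℝ) ≤ Fintype.card J2 := by exact_mod_cast (Fintype.card_pos : 0 < Fintype.card J2)
  have cc : (Fintype.card (J1 × J2) : ℝ) = Fintype.card J1 * Fintype.card J2 := by
    rw [Fintype.card_prod]; push_cast; ring
  have b1 := fbMI1_le hch.nn n1
  have b2 := fbMI2_le hch n2
  rw [t1] at b1
  rw [t2] at b2
  obtain ⟨w10⟩ := ‹Nonempty J1›
  obtain ⟨w20⟩ := ‹Nonempty J2›
  haveI : Nonempty J1 := ⟨w10⟩
  haveI : Nonempty J2 := ⟨w20⟩
  refine ⟨π, hπ1, ?_, ?_, ?_⟩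
  · have h := core_phase hch hx1 hx2 z (stochV1 hch n0) (stochV1 hch n1) hch ha1 ha2 n
      (fun p1 p2 a => V1_pos hch.nn n0 p1 p2 a) (fun p1 p2 a => V1_pos hch.nn n1 p1 p2 a)
      (fun _ _ _ _ h => h) _ c1 (fun w y => Good a1 d1 n w.1 y) ?_
    · rw [← ho0, ← ho1, ← ho2, V1_dv hch n0, V1_dv hch n1] at h
      simp only [dv_self, mul_zero, sum_const_zero, add_zero] at h
      rw [hoπ, fbMI1_smul t htot.ne'] at h
      linarith
    · rw [Fintype.sum_prod_type_right]
      refine le_trans (sum_le_sum (g := fun _ => (1:ℝ)) fun w2 _ => ?_) ?_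
      · refine QB1 z (fun w1 => _) (fun w1 => qk_ker hch hx1 hx2 (stochV1 hch n0) (stochV1 hch n1) hch ha1 ha2 (w1, w2))
          _ (qk_ker (stochV1 hch n1) hx1 hx2 (stochV1 hch n0) (stochV1 hch n1) (stochV1 hch n0) ha1 ha2 (w10, w2))
          a1 ha1 ?_ d1 hd1 n
        intro w i y ha
        funext a
        simp [qk, ha, hx1e, hx2e]
      · rw [cc]
        simp only [sum_const, card_univ, nsmul_eq_mul, mul_one]
        rw [le_div_iff₀ (by linarith)]
        nlinarith
  · have h := core_phase hch hx1 hx2 z (stochV2 hch n0) hch (stochV2 hch n2) ha1 ha2 n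
      (fun p1 p2 a => V2_pos hch n0 p1 p2 a) (fun _ _ _ _ h => h)
      (fun p1 p2 a => V2_pos hch n2 p1 p2 a) _ c2 (fun w y => Good a2 d2 n w.2 y) ?_
    · rw [← ho0, ← ho1, ← ho2, V2_dv hch n0, V2_dv hch n2] at h
      simp only [dv_self, mul_zero, sum_const_zero, add_zero] at h
      rw [hoπ, fbMI2_smul t htot.ne'] at h
      linarith
    · rw [Fintype.sum_prod_type]
      refine le_trans (sum_le_sum (g := fun _ => (1:ℝ)) fun w1 _ => ?_) ?_
      · refine QB1 z (fun w2 => _) (fun w2 => qk_ker hch hx1 hx2 (stochV2 hch n0) hch (stochV2 hch n2) ha1 ha2 (w1, w2))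
          _ (qk_ker (stochV2 hch n2) hx1 hx2 (stochV2 hch n0) (stochV2 hch n0) (stochV2 hch n2) ha1 ha2 (w1, w20))
          a2 ha2 ?_ d2 hd2 n
        intro w i y ha
        funext a
        simp [qk, ha, hx1e, hx2e]
      · rw [cc]
        simp only [sum_const, card_univ, nsmul_eq_mul, mul_one]
        rw [le_div_iff₀ (by linarith)]
        nlinarith
  · have hU : Stoch (fun (_ : X1) (_ : X2) a => ∑ x1, ∑ x2, π (x1, x2) * ch x1 x2 a) := by
      refine ⟨fun _ _ _ => sum_nonneg fun _ _ => sum_nonneg fun _ _ => mul_nonneg (hπ1.1 _) (hch.nn _ _ _),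
        fun _ _ => ?_⟩
      rw [sum_comm, ← hπ1.2, Fintype.sum_prod_type]
      refine sum_congr rfl fun p1 _ => ?_
      rw [sum_comm]
      simp_rw [← mul_sum, hch.one, mul_one]
    have hUd : ∑ p1, ∑ p2, o0 (p1, p2) * dv ch (fun (_ : X1) (_ : X2) a => ∑ x1, ∑ x2, π (x1, x2) * ch x1 x2 a) p1 p2
        = t * fbMI12 ch π := by
      rw [hoπ]
      unfold dv fbMI12
      simp_rw [mul_sum, mul_assoc]
    have hUk : Ker (fun (_ : ℕ) (_ : ℕ → Y) a => ∑ x1, ∑ x2, π (x1, x2) * ch x1 x2 a) := by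
      have hX : Nonempty X1 := ⟨e1 w10 0 fun _ => z⟩
      have hX' : Nonempty X2 := ⟨e2 w20 0 fun _ => z⟩
      exact ⟨fun _ _ _ _ => rfl, fun _ _ _ => hU.nn hX.some hX'.some _, fun _ _ => hU.one hX.some hX'.some⟩
    have h := core_phase hch hx1 hx2 z hU (stochV1 hch n1) (stochV2 hch n2) ha1 ha2 n
      ?_ (fun p1 p2 a => V1_pos hch.nn n1 p1 p2 a)
      (fun p1 p2 a => V2_pos hch n2 p1 p2 a) (Fintype.card J1 * Fintype.card J2) (by nlinarith)
      (fun w y => Good a1 d1 n w.1 y ∧ Good a2 d2 n w.2 y) ?_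
    · rw [← ho0, ← ho1, ← ho2, V1_dv hch n1, V2_dv hch n2, hUd] at h
      linarith
    · intro p1 p2 a hp hc
      refine lt_of_lt_of_le (mul_pos ?_ hc) (pair_le hch.nn hπ1.1 p1 p2 a)
      exact div_pos hp htot
    · rw [Fintype.sum_prod_type, ← cc, mul_div_assoc, div_self (by rw [cc]; nlinarith), mul_one]
      refine Q12 z (fun w1 w2 => _) (fun w1 w2 => qk_ker hch hx1 hx2 hU (stochV1 hch n1) (stochV2 hch n2) ha1 ha2 (w1, w2))
        (fun w1 => _) (fun w1 => qk_ker (stochV2 hch n2) hx1 hx2 hU hU (stochV2 hch n2) ha1 ha2 (w1, w20))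
        (fun w2 => _) (fun w2 => qk_ker (stochV1 hch n1) hx1 hx2 hU (stochV1 hch n1) hU ha1 ha2 (w10, w2))
        _ hUk a1 a2 ha1 ha2 ?_ ?_ ?_ ?_ d1 hd1 d2 hd2 n
      · intro w w' i y ha
        funext a
        simp [qk, ha, hx1e, hx2e]
      · intro w w' i y ha
        funext a
        simp [qk, ha, hx1e, hx2e]
      · intro w i y ha
        funext a
        simp [qk, ha]
      · intro w i y ha
        funext a
        simp [qk, ha]
end

section
variable {X1 X2 Y : Type} [Fintype X1] [Fintype X2] [Fintype Y]

lemma gibbs (c v : Y → ℝ) (hc : ∀ a, 0 ≤ c a) (hv : ∀ a, 0 ≤ v a) (hcv : ∀ a, 0 < c a → 0 < v a)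
    (h1 : ∑ a, c a = 1) (h2 : ∑ a, v a = 1) : 0 ≤ ∑ a, c a * Real.log (c a / v a) := by
  have : ∑ a, (c a - v a) ≤ ∑ a, c a * Real.log (c a / v a) := by
    refine sum_le_sum fun a _ => ?_
    rcases (hc a).eq_or_lt with h | h
    · rw [← h]; simp [hv a]
    · have hva := hcv a h
      have h3 := Real.one_sub_inv_le_log_of_pos (div_pos h hva)
      calc c a - v a = c a * (1 - (c a / v a)⁻¹) := by field_simp
        _ ≤ _ := mul_le_mul_of_nonneg_left h3 h.le
  rw [sum_sub_distrib, h1, h2] at this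
  linarith

lemma fbMI1_nn {ch : X1 → X2 → Y → ℝ} (hch : Stoch ch) {o : X1 × X2 → ℝ} (ho : ∀ p, 0 ≤ o p) :
    0 ≤ fbMI1 ch o := by
  rw [← V1_mi hch.nn ho]
  refine sum_nonneg fun x1 _ => sum_nonneg fun x2 _ => ?_
  rcases (ho (x1, x2)).eq_or_lt with h | h
  · rw [← h]; simp
  · haveI : Nonempty Y := by
      by_contra hY
      have := hch.one x1 x2
      rw [not_nonempty_iff] at hY
      simp at this
    exact mul_nonneg h.le (gibbs _ _ (hch.nn _ _) (V1_nn hch.nn ho x2)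
      (fun a => V1_pos hch.nn ho x1 x2 a h) (hch.one _ _) (V1_sum hch.nn hch.one ho x2))

lemma fbMI2_nn {ch : X1 → X2 → Y → ℝ} (hch : Stoch ch) {o : X1 × X2 → ℝ} (ho : ∀ p, 0 ≤ o p) :
    0 ≤ fbMI2 ch o := by
  rw [fbMI2_eq]
  exact fbMI1_nn (ch := fun x2 x1 => ch x1 x2) ⟨fun _ _ _ => hch.nn _ _ _, fun _ _ => hch.one _ _⟩ (fun _ => ho _)

lemma fbMI12_nn {ch : X1 → X2 → Y → ℝ} (hch : Stoch ch) {o : X1 × X2 → ℝ} (ho : IsPMF o) :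
    0 ≤ fbMI12 ch o := by
  unfold fbMI12
  refine sum_nonneg fun x1 _ => sum_nonneg fun x2 _ => ?_
  simp_rw [mul_assoc]
  rw [← mul_sum]
  rcases (ho.1 (x1, x2)).eq_or_lt with h | h
  · rw [← h]; simp
  · refine mul_nonneg h.le (gibbs _ _ (hch.nn _ _) (fun a => sum_nonneg fun _ _ => sum_nonneg fun _ _ =>
      mul_nonneg (ho.1 _) (hch.nn _ _ _)) (fun a ha => lt_of_lt_of_le (mul_pos h ha) (pair_le hch.nn ho.1 x1 x2 a))
      (hch.one _ _) ?_)
    rw [sum_comm, ← ho.2, Fintype.sum_prod_type]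
    refine sum_congr rfl fun x1 _ => ?_
    rw [sum_comm]
    refine sum_congr rfl fun x2 _ => ?_
    rw [← mul_sum, hch.one, mul_one]

end

section
variable {Ω A I : Type} [Fintype A] [Fintype I] [Nonempty I] [MeasurableSpace Ω] {P : Measure Ω}
  [IsProbabilityMeasure P] {W : Ω → I} {Y : ℕ → Ω → A} (z : A) {k : I → ℕ → (ℕ → A) → A → ℝ}
  (hk : ∀ w, Ker (k w))
  (hP : ∀ w n (y : ℕ → A), P {ω | W ω = w ∧ ∀ i < n, Y i ω = y i} = ENNReal.ofReal (pr (k w) n y / Fintype.card I))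

include hk hP

lemma link_le (n : ℕ) (B : I → (ℕ → A) → Prop) (hB : ∀ w, Dep n (B w)) :
    P.real {ω | B (W ω) (fun i => Y i ω)} ≤
      (∑ w, S z n (fun y => pr (k w) n y * ind (B w y))) / Fintype.card I := by
  classical
  have hsub : {ω | B (W ω) (fun i => Y i ω)} ⊆
      ⋃ w ∈ (univ : Finset I), ⋃ y ∈ (univ : Finset (Fin n → A)),
        {ω | B w (ext z n y) ∧ W ω = w ∧ ∀ i < n, Y i ω = ext z n y i} := by
    intro ω hω
    simp only [mem_univ, Set.iUnion_true, Set.mem_iUnion]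
    refine ⟨W ω, fun i => Y i ω, ?_⟩
    have he : ∀ i < n, Y i ω = ext z n (fun i => Y i ω) i := by
      intro i hi; simp [ext, hi]
    refine ⟨?_, rfl, he⟩
    have : B (W ω) (fun i => Y i ω) := hω
    rwa [hB (W ω) _ _ he] at this
  refine (measureReal_mono hsub (measure_ne_top _ _)).trans ?_
  refine (measureReal_biUnion_finset_le _ _).trans ?_
  rw [sum_div]
  refine sum_le_sum fun w _ => ?_
  refine (measureReal_biUnion_finset_le _ _).trans ?_
  rw [S, sum_div]
  refine sum_le_sum fun y _ => ?_
  by_cases h : B w (ext z n y)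
  · simp only [h, true_and, ind_true, mul_one]
    rw [Measure.real, hP, ENNReal.toReal_ofReal]
    exact div_nonneg (pr_nonneg (hk w) _ _) (by positivity)
  · simp [h, ind_false]

lemma link_eq (n : ℕ) (B : I → (ℕ → A) → Prop) (hB : ∀ w, Dep n (B w)) :
    P.real {ω | B (W ω) (fun i => Y i ω)} =
      (∑ w, S z n (fun y => pr (k w) n y * ind (B w y))) / Fintype.card I := by
  refine le_antisymm (link_le z hk hP n B hB) ?_
  have h2 := link_le z hk hP n (fun w y => ¬ B w y) (fun w y y' h => by show (¬ B w y) = (¬ B w y'); rw [hB w y y' h])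
  have h3 : (1:ℝ) ≤ P.real {ω | B (W ω) (fun i => Y i ω)} + P.real {ω | ¬ B (W ω) (fun i => Y i ω)} := by
    refine le_trans ?_ (measureReal_union_le _ _)
    rw [← probReal_univ (μ := P)]
    refine measureReal_mono (fun ω _ => ?_) (measure_ne_top _ _)
    exact em _
  have h4 : ∀ w, S z n (fun y => pr (k w) n y * ind (¬ B w y)) = 1 - S z n (fun y => pr (k w) n y * ind (B w y)) := by
    intro w
    rw [← S_pr_one z (hk w) n, ← S_sub]
    refine S_congr z fun y => ?_
    rw [ind_not]; ring
  simp_rw [h4] at h2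
  rw [sum_sub_distrib, sub_div] at h2
  have : (∑ w : I, (1:ℝ)) / Fintype.card I = 1 := by
    simp
  linarith

lemma T_eq (n : ℕ) (B : ℕ → (ℕ → A) → Prop) (hB : ∀ i, Dep i (B i)) :
    T z k n B = ∑ i ∈ range n, P.real {ω | B i (fun i => Y i ω)} := by
  unfold T
  rw [sum_comm, sum_div]
  exact sum_congr rfl fun i _ => (link_eq z hk hP i (fun _ => B i) (fun _ => hB i)).symm

end

section
variable {Ω : Type} [MeasurableSpace Ω] {P : Measure Ω} [IsProbabilityMeasure P]

lemma nm {N : Ω → ℕ} (hN : Integrable (fun ω => (N ω : ℝ)) P) (i : ℕ) :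
    NullMeasurableSet {ω | i < N ω} P := by
  have := nullMeasurableSet_lt (μ := P) (f := fun _ => (i:ℝ)) aemeasurable_const hN.aemeasurable
  simpa using this

lemma int_min {N : Ω → ℕ} (hN : Integrable (fun ω => (N ω : ℝ)) P) (n : ℕ) :
    Integrable (fun ω => ((min (N ω) n : ℕ) : ℝ)) P := by
  refine hN.mono ?_ ?_
  · have h := hN.aemeasurable.min (aemeasurable_const (b := (n:ℝ)))
    have := h.aestronglyMeasurable
    simpa [Pi.inf_def] using this
  · refine Filter.Eventually.of_forall fun ω => ?_
    rw [Real.norm_of_nonneg (by positivity), Real.norm_of_nonneg (by positivity)]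
    exact_mod_cast min_le_left _ _

lemma tail {N : Ω → ℕ} (hN : Integrable (fun ω => (N ω : ℝ)) P) (n : ℕ) :
    ∑ i ∈ range n, P.real {ω | i < N ω} = ∫ ω, ((min (N ω) n : ℕ) : ℝ) ∂P := by
  classical
  have h1 : ∀ i, P.real {ω | i < N ω} = ∫ ω, Set.indicator {ω | i < N ω} (fun _ => (1:ℝ)) ω ∂P := by
    intro i
    rw [integral_indicator₀ (nm hN i)]; simp
  simp_rw [h1]
  rw [← integral_finsetSum]
  · refine integral_congr_ae (Filter.Eventually.of_forall fun ω => ?_)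
    simp only [Set.indicator_apply, Set.mem_ofPred_eq]
    rw [← sum_filter]
    simp only [sum_const, nsmul_eq_mul, mul_one]
    have : {i ∈ range n | i < N ω} = range (min (N ω) n) := by
      ext i; simp; tauto
    rw [this, card_range]
  · intro i _
    exact (integrable_const (1:ℝ)).indicator₀ (nm hN i)

lemma tail_tendsto {N : Ω → ℕ} (hN : Integrable (fun ω => (N ω : ℝ)) P) :
    Filter.Tendsto (fun n => ∫ ω, ((min (N ω) n : ℕ) : ℝ) ∂P) Filter.atTop (nhds (∫ ω, (N ω : ℝ) ∂P)) := by
  refine tendsto_integral_of_dominated_convergence (fun ω => (N ω : ℝ)) (fun n => (int_min hN n).aestronglyMeasurable)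
    hN (fun n => Filter.Eventually.of_forall fun ω => ?_) (Filter.Eventually.of_forall fun ω => ?_)
  · rw [Real.norm_of_nonneg (by positivity)]
    exact_mod_cast min_le_left _ _
  · refine tendsto_const_nhds.congr' ?_
    filter_upwards [Filter.eventually_ge_atTop (N ω)] with n hn
    rw [min_eq_left hn]

lemma tail_zero {N : Ω → ℕ} (hN : Integrable (fun ω => (N ω : ℝ)) P) :
    Filter.Tendsto (fun n => P.real {ω | n < N ω}) Filter.atTop (nhds 0) := by
  have h := tail_tendsto hN
  simp_rw [← tail hN] at h
  have h' := (h.comp (Filter.tendsto_add_atTop_nat 1)).sub h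
  rw [sub_self] at h'
  refine h'.congr fun n => ?_
  simp [sum_range_succ]

end

section

/-- not yet stopped after seeing `i` letters of `y` -/
def al {Ω A : Type} (Y : ℕ → Ω → A) (N : Ω → ℕ) (i : ℕ) (y : ℕ → A) : Prop :=
  ∃ ω, (∀ j < i, Y j ω = y j) ∧ i < N ω

lemma al_dep {Ω A : Type} (Y : ℕ → Ω → A) (N : Ω → ℕ) (i : ℕ) : Dep i (al Y N i) := by
  intro y y' h
  unfold al
  refine propext ⟨?_, ?_⟩
  · rintro ⟨ω, h1, h2⟩
    exact ⟨ω, fun j hj => (h1 j hj).trans (h j hj), h2⟩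
  · rintro ⟨ω, h1, h2⟩
    exact ⟨ω, fun j hj => (h1 j hj).trans (h j hj).symm, h2⟩

lemma al_iff {Ω A : Type} {Y : ℕ → Ω → A} {N : Ω → ℕ}
    (hN : ∀ (n : ℕ) (ω ω' : Ω), (∀ i < n, Y i ω = Y i ω') → N ω = n → N ω' = n) (i : ℕ) (ω : Ω) :
    al Y N i (fun j => Y j ω) ↔ i < N ω := by
  constructor
  · rintro ⟨ω', h1, h2⟩
    by_contra hlt
    have := hN (N ω) ω ω' (fun j hj => (h1 j (by omega)).symm) rfl
    omega
  · intro h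
    exact ⟨ω, fun _ _ => rfl, h⟩

/-- decoder on words -/
def dd {A J : Type} (g : (ℕ → Option A) → J) (m : ℕ) (y : ℕ → A) : J :=
  g (fun i => if i < m then some (y i) else none)

lemma dd_dep {A J : Type} (g : (ℕ → Option A) → J) (m : ℕ) : Dep m (dd g m) := by
  intro y y' h
  unfold dd
  congr 1
  funext i
  split_ifs with hi
  · rw [h i hi]
  · rfl

lemma Good_dep {A J : Type} [Fintype A] {a : ℕ → (ℕ → A) → Prop} (ha : ∀ i, Dep i (a i)) {d : ℕ → (ℕ → A) → J}
    (hd : ∀ i, Dep i (d i)) (n : ℕ) (w : J) : Dep n (Good a d n w) := by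
  intro y y' h
  unfold Good
  have : ∀ m ∈ range (n+1), (halt a m y ∧ d m y = w) = (halt a m y' ∧ d m y' = w) := by
    intro m hm
    rw [mem_range] at hm
    rw [halt_dep ha m y y' fun j hj => h j (by omega), hd m y y' fun j hj => h j (by omega)]
  refine propext ⟨?_, ?_⟩
  · rintro ⟨m, hm, hh⟩; exact ⟨m, hm, (this m hm) ▸ hh⟩
  · rintro ⟨m, hm, hh⟩; exact ⟨m, hm, (this m hm).symm ▸ hh⟩

lemma Good_of {Ω A J : Type} {Y : ℕ → Ω → A} {N : Ω → ℕ}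
    (hN : ∀ (n : ℕ) (ω ω' : Ω), (∀ i < n, Y i ω = Y i ω') → N ω = n → N ω' = n)
    (g : (ℕ → Option A) → J) (n : ℕ) (ω : Ω) (hn : N ω ≤ n) :
    Good (al Y N) (dd g) n (g (Yprefix Y N ω)) (fun j => Y j ω) := by
  refine ⟨N ω, by rw [mem_range]; omega, ⟨?_, ?_⟩, rfl⟩
  · rw [al_iff hN]; omega
  · intro i hi; rw [al_iff hN]; omega

lemma per_code {X1 X2 A : Type} [Fintype X1] [Fintype X2] [Fintype A] {ch : X1 → X2 → A → ℝ} (hch : Stoch ch)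
    {Ω : Type} [MeasurableSpace Ω] {P : Measure Ω} [IsProbabilityMeasure P]
    {M₁ M₂ : ℕ} (hM1 : 0 < M₁) (hM2 : 0 < M₂) {W₁ : Ω → Fin M₁} {W₂ : Ω → Fin M₂}
    {enc1 : ℕ → Fin M₁ → (ℕ → A) → X1} {enc2 : ℕ → Fin M₂ → (ℕ → A) → X2}
    {Y : ℕ → Ω → A} {N₁ N₂ : Ω → ℕ}
    {g₁ : (ℕ → Option A) → Fin M₁} {g₂ : (ℕ → Option A) → Fin M₂}
    (he1 : ∀ (i : ℕ) (w₁ : Fin M₁) (y y' : ℕ → A),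
          (∀ j < i, y j = y' j) → enc1 i w₁ y = enc1 i w₁ y')
    (he2 : ∀ (i : ℕ) (w₂ : Fin M₂) (y y' : ℕ → A),
          (∀ j < i, y j = y' j) → enc2 i w₂ y = enc2 i w₂ y')
    (hP : ∀ (w₁ : Fin M₁) (w₂ : Fin M₂) (n : ℕ) (y : ℕ → A),
          P {ω | W₁ ω = w₁ ∧ W₂ ω = w₂ ∧ ∀ i < n, Y i ω = y i} =
            ENNReal.ofReal ((1 / ((M₁ : ℝ) * (M₂ : ℝ))) *
              ∏ i ∈ Finset.range n, ch (enc1 i w₁ y) (enc2 i w₂ y) (y i)))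
    (hN1 : ∀ (n : ℕ) (ω ω' : Ω), (∀ i < n, Y i ω = Y i ω') → N₁ ω = n → N₁ ω' = n)
    (hN2 : ∀ (n : ℕ) (ω ω' : Ω), (∀ i < n, Y i ω = Y i ω') → N₂ ω = n → N₂ ω' = n)
    (hi1 : Integrable (fun ω => (N₁ ω : ℝ)) P) (hi2 : Integrable (fun ω => (N₂ ω : ℝ)) P)
    {EN₁ EN₂ EN ε : ℝ} (hE1 : EN₁ = ∫ ω, (N₁ ω : ℝ) ∂P) (hE2 : EN₂ = ∫ ω, (N₂ ω : ℝ) ∂P)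
    (hE : EN = ∫ ω, ((min (N₁ ω) (N₂ ω) : ℕ) : ℝ) ∂P) (hpos : 0 < EN) (hε : 0 < ε)
    (herr : P {ω | g₁ (Yprefix Y N₁ ω) ≠ W₁ ω ∨ g₂ (Yprefix Y N₂ ω) ≠ W₂ ω} < ENNReal.ofReal ε) :
    ∃ π : X1 × X2 → ℝ, IsPMF π ∧
      (1 - 2 * ε) * Real.log M₁ - Real.log 3 ≤ EN * fbMI1 ch π + (EN₁ - EN) * Cap1 ch ∧
      (1 - 2 * ε) * Real.log M₂ - Real.log 3 ≤ EN * fbMI2 ch π + (EN₂ - EN) * Cap2 ch ∧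
      (1 - 2 * ε) * (Real.log M₁ + Real.log M₂) - Real.log 3 ≤ EN * fbMI12 ch π
        + (EN₁ - EN) * Cap1 ch + (EN₂ - EN) * Cap2 ch := by
  classical
  haveI : Nonempty (Fin M₁) := ⟨⟨0, hM1⟩⟩
  haveI : Nonempty (Fin M₂) := ⟨⟨0, hM2⟩⟩
  obtain ⟨ω0⟩ : Nonempty Ω := nonempty_of_isProbabilityMeasure P
  set z : A := Y 0 ω0 with hz
  let e1 : Fin M₁ → ℕ → (ℕ → A) → X1 := fun w i => enc1 i w
  let e2 : Fin M₂ → ℕ → (ℕ → A) → X2 := fun w i => enc2 i w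
  have hd1 : ∀ w i, Dep i (e1 w i) := fun w i => he1 i w
  have hd2 : ∀ w i, Dep i (e2 w i) := fun w i => he2 i w
  obtain ⟨k, hk⟩ : ∃ k, k = kk ch (fun w : Fin M₁ × Fin M₂ => e1 w.1) (fun w => e2 w.2) := ⟨_, rfl⟩
  have hker : ∀ w, Ker (k w) := fun w => by
    rw [hk]; exact kk_ker hch (fun w => hd1 w.1) (fun w => hd2 w.2) w
  have hcard : (Fintype.card (Fin M₁ × Fin M₂) : ℝ) = M₁ * M₂ := by simp
  have hP' : ∀ w n (y : ℕ → A), P {ω | (W₁ ω, W₂ ω) = w ∧ ∀ i < n, Y i ω = y i}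
      = ENNReal.ofReal (pr (k w) n y / Fintype.card (Fin M₁ × Fin M₂)) := by
    intro w n y
    have h := hP w.1 w.2 n y
    rw [hcard, hk]
    simp only [Prod.ext_iff, and_assoc]
    rw [h]
    congr 1
    rw [one_div, inv_mul_eq_div]
    rfl
  have hi : Integrable (fun ω => ((min (N₁ ω) (N₂ ω) : ℕ) : ℝ)) P := by
    have := hi1.inf hi2
    simpa [Pi.inf_def] using this
  have hB0 : ∀ i, Dep i (fun y => al Y N₁ i y ∧ al Y N₂ i y) := fun i y y' h => by
    simp only [al_dep Y N₁ i y y' h, al_dep Y N₂ i y y' h]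
  have hB1 : ∀ i, Dep i (fun y => al Y N₁ i y ∧ ¬ al Y N₂ i y) := fun i y y' h => by
    simp only [al_dep Y N₁ i y y' h, al_dep Y N₂ i y y' h]
  have hB2 : ∀ i, Dep i (fun y => ¬ al Y N₁ i y ∧ al Y N₂ i y) := fun i y y' h => by
    simp only [al_dep Y N₁ i y y' h, al_dep Y N₂ i y y' h]
  -- values of T
  have hT0 : ∀ n, T z k n (fun i y => al Y N₁ i y ∧ al Y N₂ i y)
      = ∫ ω, ((min (min (N₁ ω) (N₂ ω)) n : ℕ) : ℝ) ∂P := by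
    intro n
    rw [T_eq z hker hP' n _ hB0, ← tail hi]
    simp only [al_iff hN1, al_iff hN2, lt_min_iff]
  have hT1a : ∀ n, T z k n (al Y N₁) = ∫ ω, ((min (N₁ ω) n : ℕ) : ℝ) ∂P := by
    intro n
    rw [T_eq z hker hP' n _ (al_dep Y N₁), ← tail hi1]
    simp only [al_iff hN1]
  have hT2a : ∀ n, T z k n (al Y N₂) = ∫ ω, ((min (N₂ ω) n : ℕ) : ℝ) ∂P := by
    intro n
    rw [T_eq z hker hP' n _ (al_dep Y N₂), ← tail hi2]
    simp only [al_iff hN2]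
  have hs1 : ∀ n, T z k n (fun i y => al Y N₁ i y ∧ ¬ al Y N₂ i y)
      = T z k n (al Y N₁) - T z k n (fun i y => al Y N₁ i y ∧ al Y N₂ i y) := by
    intro n
    unfold T
    rw [← sub_div, ← sum_sub_distrib]
    simp_rw [← sum_sub_distrib, ← S_sub]
    congr 1
    refine sum_congr rfl fun w _ => sum_congr rfl fun i _ => S_congr z fun y => ?_
    rw [ind_and, ind_and, ind_not]; ring
  have hs2 : ∀ n, T z k n (fun i y => ¬ al Y N₁ i y ∧ al Y N₂ i y)
      = T z k n (al Y N₂) - T z k n (fun i y => al Y N₁ i y ∧ al Y N₂ i y) := by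
    intro n
    unfold T
    rw [← sub_div, ← sum_sub_distrib]
    simp_rw [← sum_sub_distrib, ← S_sub]
    congr 1
    refine sum_congr rfl fun w _ => sum_congr rfl fun i _ => S_congr z fun y => ?_
    rw [ind_and, ind_and, ind_not]; ring
  have hl0 : ∀ n, T z k n (fun i y => al Y N₁ i y ∧ al Y N₂ i y) ≤ EN := by
    intro n
    rw [hT0, hE]
    refine integral_mono (int_min hi n) hi fun ω => ?_
    show ((min (min (N₁ ω) (N₂ ω)) n : ℕ) : ℝ) ≤ ((min (N₁ ω) (N₂ ω) : ℕ) : ℝ)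
    exact_mod_cast min_le_left _ _
  have hl1 : ∀ n, T z k n (fun i y => al Y N₁ i y ∧ ¬ al Y N₂ i y) ≤ EN₁ - EN := by
    intro n
    rw [hs1, hT0, hT1a, hE, hE1, ← integral_sub (int_min hi1 n) (int_min hi n), ← integral_sub hi1 hi]
    refine integral_mono ((int_min hi1 n).sub (int_min hi n)) (hi1.sub hi) fun ω => ?_
    have : min (N₁ ω) n + min (N₁ ω) (N₂ ω) ≤ N₁ ω + min (min (N₁ ω) (N₂ ω)) n := by omega
    have h' : ((min (N₁ ω) n : ℕ) : ℝ) + ((min (N₁ ω) (N₂ ω) : ℕ) : ℝ)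
      ≤ (N₁ ω : ℝ) + ((min (min (N₁ ω) (N₂ ω)) n : ℕ) : ℝ) := by exact_mod_cast this
    simp only
    linarith
  have hl2 : ∀ n, T z k n (fun i y => ¬ al Y N₁ i y ∧ al Y N₂ i y) ≤ EN₂ - EN := by
    intro n
    rw [hs2, hT0, hT2a, hE, hE2, ← integral_sub (int_min hi2 n) (int_min hi n), ← integral_sub hi2 hi]
    refine integral_mono ((int_min hi2 n).sub (int_min hi n)) (hi2.sub hi) fun ω => ?_
    have : min (N₂ ω) n + min (N₁ ω) (N₂ ω) ≤ N₂ ω + min (min (N₁ ω) (N₂ ω)) n := by omega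
    have h' : ((min (N₂ ω) n : ℕ) : ℝ) + ((min (N₁ ω) (N₂ ω) : ℕ) : ℝ)
      ≤ (N₂ ω : ℝ) + ((min (min (N₁ ω) (N₂ ω)) n : ℕ) : ℝ) := by exact_mod_cast this
    simp only
    linarith
  -- choose n
  have hev0 := (tail_tendsto hi).eventually (lt_mem_nhds (hE ▸ hpos))
  have hev1 := (tail_zero hi1).eventually (gt_mem_nhds (half_pos hε))
  have hev2 := (tail_zero hi2).eventually (gt_mem_nhds (half_pos hε))
  obtain ⟨n, h0, h1, h2⟩ := (hev0.and (hev1.and hev2)).exists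
  rw [← hT0] at h0
  obtain ⟨π, hπ, b1, b2, b3⟩ := fin_bounds hch hd1 hd2 z (al_dep Y N₁) (al_dep Y N₂) (dd g₁) (dd_dep g₁)
    (dd g₂) (dd_dep g₂) n k hk h0
  have hG1 : ∀ w : Fin M₁ × Fin M₂, Dep n (fun y => Good (al Y N₁) (dd g₁) n w.1 y) :=
    fun w => Good_dep (al_dep Y N₁) (dd_dep g₁) n w.1
  have hG2 : ∀ w : Fin M₁ × Fin M₂, Dep n (fun y => Good (al Y N₂) (dd g₂) n w.2 y) :=
    fun w => Good_dep (al_dep Y N₂) (dd_dep g₂) n w.2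
  have hG12 : ∀ w : Fin M₁ × Fin M₂, Dep n (fun y => Good (al Y N₁) (dd g₁) n w.1 y ∧ Good (al Y N₂) (dd g₂) n w.2 y) := by
    intro w y y' h
    have e1 := hG1 w y y' h
    have e2 := hG2 w y y' h
    simp only at e1 e2 ⊢
    rw [e1, e2]
  rw [← link_eq z hker hP' n (fun w y => Good (al Y N₁) (dd g₁) n w.1 y) hG1] at b1
  rw [← link_eq z hker hP' n (fun w y => Good (al Y N₂) (dd g₂) n w.2 y) hG2] at b2
  rw [← link_eq z hker hP' n (fun w y => Good (al Y N₁) (dd g₁) n w.1 y ∧ Good (al Y N₂) (dd g₂) n w.2 y) hG12] at b3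
  simp only [Fintype.card_fin] at b1 b2 b3
  have hp3 : 1 - 2 * ε ≤ P.real {ω | Good (al Y N₁) (dd g₁) n (W₁ ω) (fun i => Y i ω) ∧
      Good (al Y N₂) (dd g₂) n (W₂ ω) (fun i => Y i ω)} := by
    have herr' : P.real {ω | g₁ (Yprefix Y N₁ ω) ≠ W₁ ω ∨ g₂ (Yprefix Y N₂ ω) ≠ W₂ ω} < ε := by
      rw [Measure.real, ← ENNReal.toReal_ofReal hε.le]
      exact (ENNReal.toReal_lt_toReal (measure_ne_top _ _) ENNReal.ofReal_ne_top).2 herr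
    have hcov : (Set.univ : Set Ω) ⊆ ({ω | Good (al Y N₁) (dd g₁) n (W₁ ω) (fun i => Y i ω) ∧
      Good (al Y N₂) (dd g₂) n (W₂ ω) (fun i => Y i ω)} ∪
        {ω | g₁ (Yprefix Y N₁ ω) ≠ W₁ ω ∨ g₂ (Yprefix Y N₂ ω) ≠ W₂ ω}) ∪ ({ω | n < N₁ ω} ∪ {ω | n < N₂ ω}) := by
      intro ω _
      by_cases c1 : n < N₁ ω
      · exact Or.inr (Or.inl c1)
      by_cases c2 : n < N₂ ω
      · exact Or.inr (Or.inr c2)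
      by_cases c3 : g₁ (Yprefix Y N₁ ω) ≠ W₁ ω ∨ g₂ (Yprefix Y N₂ ω) ≠ W₂ ω
      · exact Or.inl (Or.inr c3)
      push Not at c1 c2 c3
      refine Or.inl (Or.inl ⟨?_, ?_⟩)
      · rw [← c3.1]; exact Good_of hN1 g₁ n ω c1
      · rw [← c3.2]; exact Good_of hN2 g₂ n ω c2
    have := measureReal_mono hcov (measure_ne_top P _)
    rw [probReal_univ] at this
    have u1 := measureReal_union_le (μ := P) ({ω | Good (al Y N₁) (dd g₁) n (W₁ ω) (fun i => Y i ω) ∧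
      Good (al Y N₂) (dd g₂) n (W₂ ω) (fun i => Y i ω)} ∪
        {ω | g₁ (Yprefix Y N₁ ω) ≠ W₁ ω ∨ g₂ (Yprefix Y N₂ ω) ≠ W₂ ω}) ({ω | n < N₁ ω} ∪ {ω | n < N₂ ω})
    have u2 := measureReal_union_le (μ := P) {ω | Good (al Y N₁) (dd g₁) n (W₁ ω) (fun i => Y i ω) ∧
      Good (al Y N₂) (dd g₂) n (W₂ ω) (fun i => Y i ω)}
        {ω | g₁ (Yprefix Y N₁ ω) ≠ W₁ ω ∨ g₂ (Yprefix Y N₂ ω) ≠ W₂ ω}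
    have u3 := measureReal_union_le (μ := P) {ω | n < N₁ ω} {ω | n < N₂ ω}
    linarith
  have hp1 : 1 - 2 * ε ≤ P.real {ω | Good (al Y N₁) (dd g₁) n (W₁ ω) (fun i => Y i ω)} :=
    hp3.trans (measureReal_mono (fun ω h => h.1) (measure_ne_top _ _))
  have hp2 : 1 - 2 * ε ≤ P.real {ω | Good (al Y N₂) (dd g₂) n (W₂ ω) (fun i => Y i ω)} :=
    hp3.trans (measureReal_mono (fun ω h => h.2) (measure_ne_top _ _))
  have hL1 : 0 ≤ Real.log M₁ := Real.log_natCast_nonneg _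
  have hL2 : 0 ≤ Real.log M₂ := Real.log_natCast_nonneg _
  have hI1 := fbMI1_nn hch hπ.1
  have hI2 := fbMI2_nn hch hπ.1
  have hI12 := fbMI12_nn hch hπ
  have hC1 : 0 ≤ Cap1 ch := by have := fbMI1_le hch.nn hπ.1; rw [hπ.2, one_mul] at this; linarith
  have hC2 : 0 ≤ Cap2 ch := by have := fbMI2_le hch hπ.1; rw [hπ.2, one_mul] at this; linarith
  rw [Real.log_mul (by positivity) (by positivity)] at b3
  refine ⟨π, hπ, ?_, ?_, ?_⟩
  · have q1 := mul_le_mul_of_nonneg_right hp1 hL1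
    have q2 := mul_le_mul_of_nonneg_right (hl0 n) hI1
    have q3 := mul_le_mul_of_nonneg_right (hl1 n) hC1
    linarith
  · have q1 := mul_le_mul_of_nonneg_right hp2 hL2
    have q2 := mul_le_mul_of_nonneg_right (hl0 n) hI2
    have q3 := mul_le_mul_of_nonneg_right (hl2 n) hC2
    linarith
  · have q1 := mul_le_mul_of_nonneg_right hp3 (add_nonneg hL1 hL2)
    have q2 := mul_le_mul_of_nonneg_right (hl0 n) hI12
    have q3 := mul_le_mul_of_nonneg_right (hl1 n) hC1
    have q4 := mul_le_mul_of_nonneg_right (hl2 n) hC2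
    linarith

end

lemma arith {EN₁ EN₂ EN r₁ r₂ s ε R₁ R₂ L1 L2 I1 I2 I12 C1 C2 l : ℝ} (hr₁ : 0 < r₁) (hr₂ : 0 ≤ r₂)
    (hs : s = r₂ / r₁) (hε : 0 < ε) (hε' : ε ≤ 1 / 2) (hl : 0 ≤ l)
    (h1 : R₁ ≤ L1 / EN₁) (h2 : R₂ ≤ L2 / EN₂) (ha : r₁ ≤ EN / EN₁) (hb : r₂ ≤ EN / EN₂)
    (hE : EN₁ / EN₂ = s) (hE1 : 1 / ε ≤ EN₁) (hE2 : 1 / ε ≤ EN₂)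
    (hI1 : I1 ≤ C1) (hI2 : I2 ≤ C2)
    (b1 : (1 - 2 * ε) * L1 - l ≤ EN * I1 + (EN₁ - EN) * C1)
    (b2 : (1 - 2 * ε) * L2 - l ≤ EN * I2 + (EN₂ - EN) * C2)
    (b3 : (1 - 2 * ε) * (L1 + L2) - l ≤ EN * I12 + (EN₁ - EN) * C1 + (EN₂ - EN) * C2) :
    (1 - 2 * ε) * R₁ ≤ r₁ * I1 + (1 - r₁) * C1 + ε * l ∧
    (1 - 2 * ε) * R₂ ≤ r₂ * I2 + (1 - r₂) * C2 + ε * l ∧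
    (1 - 2 * ε) * (s * R₁ + R₂) ≤ r₂ * I12 + s * (1 - r₁) * C1 + (1 - r₂) * C2 + (s + 1) * (ε * l) := by
  have p1 : 0 < EN₁ := lt_of_lt_of_le (by positivity) hE1
  have p2 : 0 < EN₂ := lt_of_lt_of_le (by positivity) hE2
  have hs0 : 0 ≤ s := by rw [hs]; positivity
  have hsr : s * r₁ = r₂ := by rw [hs]; field_simp
  have hEs : EN₁ = s * EN₂ := by rw [← hE]; field_simp
  rw [le_div_iff₀ p1] at h1 ha
  rw [le_div_iff₀ p2] at h2 hb
  rw [div_le_iff₀ hε] at hE1 hE2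
  have hε2 : 0 ≤ 1 - 2 * ε := by linarith
  have l1 : l ≤ EN₁ * ε * l := le_mul_of_one_le_left hl hE1
  have l2 : l ≤ EN₂ * ε * l := le_mul_of_one_le_left hl hE2
  have q1 := mul_le_mul_of_nonneg_left h1 hε2
  have q2 := mul_le_mul_of_nonneg_left h2 hε2
  have g1 : (1 - 2 * ε) * R₁ ≤ r₁ * I1 + (1 - r₁) * C1 + ε * l := by
    have m := mul_le_mul_of_nonneg_right ha (sub_nonneg.2 hI1)
    refine le_of_mul_le_mul_right ?_ p1
    nlinarith
  have g2 : (1 - 2 * ε) * R₂ ≤ r₂ * I2 + (1 - r₂) * C2 + ε * l := by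
    have m := mul_le_mul_of_nonneg_right hb (sub_nonneg.2 hI2)
    refine le_of_mul_le_mul_right ?_ p2
    nlinarith
  have hεl : 0 ≤ ε * l := by positivity
  refine ⟨g1, g2, ?_⟩
  have e : s * (1 - r₁) * C1 = s * C1 - r₂ * C1 := by rw [← hsr]; ring
  rw [e]
  rcases le_total I12 (C1 + C2) with hc | hc
  · have m := mul_le_mul_of_nonneg_right hb (sub_nonneg.2 hc)
    have hsl : 0 ≤ s * (ε * l) := by positivity
    have : (1 - 2 * ε) * (s * R₁ + R₂) ≤ r₂ * I12 + (s * C1 - r₂ * C1) + (1 - r₂) * C2 + ε * l := by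
      refine le_of_mul_le_mul_right ?_ p2
      rw [hEs] at q1 b3
      nlinarith
    linarith
  · have m := mul_le_mul_of_nonneg_left hc hr₂
    have g1' : (1 - 2 * ε) * R₁ ≤ C1 + ε * l := by
      have := mul_le_mul_of_nonneg_left hI1 hr₁.le
      linarith
    have g2' : (1 - 2 * ε) * R₂ ≤ C2 + ε * l := by
      have := mul_le_mul_of_nonneg_left hI2 hr₂
      linarith
    have := mul_le_mul_of_nonneg_left g1' hs0
    linarith

open Filter in
lemma limit {X : Type} [Fintype X] {f1 f2 f3 : (X → ℝ) → ℝ}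
    (c1 : ContinuousOn f1 {π | ∀ p, 0 ≤ π p}) (c2 : ContinuousOn f2 {π | ∀ p, 0 ≤ π p})
    (c3 : ContinuousOn f3 {π | ∀ p, 0 ≤ π p}) {A1 A2 A3 k1 k2 k3 m1 m2 m3 d1 d2 d3 : ℝ}
    (h : ∀ ε : ℝ, 0 < ε → ε ≤ 1 / 2 → ∃ π, IsPMF π ∧ (1 - 2 * ε) * A1 ≤ k1 * f1 π + m1 + d1 * ε ∧
      (1 - 2 * ε) * A2 ≤ k2 * f2 π + m2 + d2 * ε ∧ (1 - 2 * ε) * A3 ≤ k3 * f3 π + m3 + d3 * ε) :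
    ∃ π, IsPMF π ∧ A1 ≤ k1 * f1 π + m1 ∧ A2 ≤ k2 * f2 π + m2 ∧ A3 ≤ k3 * f3 π + m3 := by
  let e : ℕ → ℝ := fun m => 1 / ((m : ℝ) + 1) / 2
  have he : Tendsto e atTop (nhds 0) := by
    have := (tendsto_one_div_add_atTop_nhds_zero_nat (𝕜 := ℝ)).div_const 2
    rw [zero_div] at this
    exact this
  have he0 : ∀ m, 0 < e m := fun m => by positivity
  have he1 : ∀ m, e m ≤ 1 / 2 := fun m => by
    have : 1 / ((m:ℝ) + 1) ≤ 1 := by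
      rw [div_le_one (by positivity)]; linarith [Nat.cast_nonneg (α := ℝ) m]
    simp only [e]; linarith
  choose p hp b1 b2 b3 using fun m => h (e m) (he0 m) (he1 m)
  obtain ⟨π, hπ, φ, hφ, ht⟩ := (isCompact_stdSimplex ℝ X).tendsto_subseq (x := p) (fun m => hp m)
  have hπ' : IsPMF π := hπ
  have hw : Tendsto (p ∘ φ) atTop (nhdsWithin π {π | ∀ p, 0 ≤ π p}) :=
    tendsto_nhdsWithin_iff.2 ⟨ht, Eventually.of_forall fun m => (hp (φ m)).1⟩
  have heφ : Tendsto (fun m => e (φ m)) atTop (nhds 0) := he.comp hφ.tendsto_atTop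
  have key : ∀ (f : (X → ℝ) → ℝ) (A k m d : ℝ), ContinuousOn f {π | ∀ p, 0 ≤ π p} →
      (∀ j, (1 - 2 * e j) * A ≤ k * f (p j) + m + d * e j) → A ≤ k * f π + m := by
    intro f A k m d c b
    have t1 : Tendsto (fun j => (1 - 2 * e (φ j)) * A) atTop (nhds ((1 - 2 * 0) * A)) :=
      (tendsto_const_nhds.sub (heφ.const_mul 2)).mul_const A
    have t2 : Tendsto (fun j => k * f (p (φ j)) + m + d * e (φ j)) atTop (nhds (k * f π + m + d * 0)) :=
      ((((c π hπ'.1).tendsto.comp hw).const_mul k).add_const m).add (heφ.const_mul d)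
    have := le_of_tendsto_of_tendsto' t1 t2 (fun j => b (φ j))
    simpa using this
  exact ⟨π, hπ', key _ _ _ _ _ c1 b1, key _ _ _ _ _ c2 b2, key _ _ _ _ _ c3 b3⟩

end FB

/-- **Outer bound with feedback.** Same setting as Theorem 1, but the encoders
may use noiseless instantaneous output feedback: `x_{ji}` depends on the
message and on the past outputs `y^{i-1}`.  If `(R₁,R₂)` is achievable in
`𝒞_{r₁,r₂}` by such feedback codes, then there is a joint input distribution
`p(x₁,x₂)` (with the output related to the inputs through the channel)
such that `R₁ ≤ r₁·I(X₁;Y|X₂) + (1−r₁)C₁`,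
`R₂ ≤ r₂·I(X₂;Y|X₁) + (1−r₂)C₂` and
`s·R₁ + R₂ ≤ r₂·I(X₁,X₂;Y) + s(1−r₁)C₁ + (1−r₂)C₂`. -/
theorem outer_bound_with_feedback
    {𝒳₁ 𝒳₂ 𝒴 : Type} [Fintype 𝒳₁] [Fintype 𝒳₂] [Fintype 𝒴]
    (ch : 𝒳₁ → 𝒳₂ → 𝒴 → ℝ)
    (hch0 : ∀ x₁ x₂ y, 0 ≤ ch x₁ x₂ y)
    (hch1 : ∀ x₁ x₂, ∑ y, ch x₁ x₂ y = 1)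
    (r₁ r₂ s : ℝ) (hr₁ : 0 < r₁) (hr₁' : r₁ ≤ 1) (hr₂ : 0 ≤ r₂) (hr₂' : r₂ ≤ 1)
    (hs : s = r₂ / r₁)
    (R₁ R₂ : ℝ)
    (hach : ∀ ε : ℝ, 0 < ε →
      ∃ (Ω : Type) (_ : MeasurableSpace Ω) (P : Measure Ω)
        (_ : IsProbabilityMeasure P)
        (M₁ M₂ : ℕ) (W₁ : Ω → Fin M₁) (W₂ : Ω → Fin M₂)
        (enc1 : ℕ → Fin M₁ → (ℕ → 𝒴) → 𝒳₁)
        (enc2 : ℕ → Fin M₂ → (ℕ → 𝒴) → 𝒳₂)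
        (Y : ℕ → Ω → 𝒴) (N₁ N₂ : Ω → ℕ)
        (g₁ : (ℕ → Option 𝒴) → Fin M₁) (g₂ : (ℕ → Option 𝒴) → Fin M₂)
        (EN₁ EN₂ EN : ℝ),
        0 < M₁ ∧ 0 < M₂ ∧
        -- the encoders are causal: `x_{ji}` depends only on `y^{i-1}`
        (∀ (i : ℕ) (w₁ : Fin M₁) (y y' : ℕ → 𝒴),
          (∀ j < i, y j = y' j) → enc1 i w₁ y = enc1 i w₁ y') ∧
        (∀ (i : ℕ) (w₂ : Fin M₂) (y y' : ℕ → 𝒴),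
          (∀ j < i, y j = y' j) → enc2 i w₂ y = enc2 i w₂ y') ∧
        -- independent uniform messages, memoryless channel with feedback
        (∀ (w₁ : Fin M₁) (w₂ : Fin M₂) (n : ℕ) (y : ℕ → 𝒴),
          P {ω | W₁ ω = w₁ ∧ W₂ ω = w₂ ∧ ∀ i < n, Y i ω = y i} =
            ENNReal.ofReal ((1 / ((M₁ : ℝ) * (M₂ : ℝ))) *
              ∏ i ∈ Finset.range n, ch (enc1 i w₁ y) (enc2 i w₂ y) (y i))) ∧
        -- the decoding times are stopping times for the outputs
        (∀ (n : ℕ) (ω ω' : Ω),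
          (∀ i < n, Y i ω = Y i ω') → N₁ ω = n → N₁ ω' = n) ∧
        (∀ (n : ℕ) (ω ω' : Ω),
          (∀ i < n, Y i ω = Y i ω') → N₂ ω = n → N₂ ω' = n) ∧
        Integrable (fun ω => (N₁ ω : ℝ)) P ∧
        Integrable (fun ω => (N₂ ω : ℝ)) P ∧
        EN₁ = ∫ ω, (N₁ ω : ℝ) ∂P ∧
        EN₂ = ∫ ω, (N₂ ω : ℝ) ∂P ∧
        EN = ∫ ω, ((min (N₁ ω) (N₂ ω) : ℕ) : ℝ) ∂P ∧
        R₁ ≤ Real.log M₁ / EN₁ ∧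
        R₂ ≤ Real.log M₂ / EN₂ ∧
        P {ω | g₁ (Yprefix Y N₁ ω) ≠ W₁ ω ∨ g₂ (Yprefix Y N₂ ω) ≠ W₂ ω} <
          ENNReal.ofReal ε ∧
        r₁ ≤ EN / EN₁ ∧ r₂ ≤ EN / EN₂ ∧ EN₁ / EN₂ = s ∧
        1 / ε ≤ EN₁ ∧ 1 / ε ≤ EN₂) :
    ∃ π : 𝒳₁ × 𝒳₂ → ℝ,
      IsPMF π ∧
      R₁ ≤ r₁ * fbMI1 ch π + (1 - r₁) * Cap1 ch ∧
      R₂ ≤ r₂ * fbMI2 ch π + (1 - r₂) * Cap2 ch ∧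
      s * R₁ + R₂ ≤ r₂ * fbMI12 ch π +
        s * (1 - r₁) * Cap1 ch + (1 - r₂) * Cap2 ch := by
  have hch : FB.Stoch ch := ⟨hch0, hch1⟩
  obtain ⟨π, hπ, k1, k2, k3⟩ := FB.limit (FB.cont1 hch0 hch1) (FB.cont2 hch0 hch1) (FB.cont12 hch0)
    (A1 := R₁) (A2 := R₂) (A3 := s * R₁ + R₂) (k1 := r₁) (k2 := r₂) (k3 := r₂)
    (m1 := (1 - r₁) * Cap1 ch) (m2 := (1 - r₂) * Cap2 ch)
    (m3 := s * (1 - r₁) * Cap1 ch + (1 - r₂) * Cap2 ch)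
    (d1 := Real.log 3) (d2 := Real.log 3) (d3 := (s + 1) * Real.log 3) (by
      intro ε hε hε'
      obtain ⟨Ω, _, P, _, M₁, M₂, W₁, W₂, enc1, enc2, Y, N₁, N₂, g₁, g₂, EN₁, EN₂, EN, hM1, hM2, he1, he2,
        hP, hN1, hN2, hi1, hi2, hE1, hE2, hE, hR1, hR2, herr, ha, hb, hEs, hl1, hl2⟩ := hach ε hε
      have p1 : 0 < EN₁ := lt_of_lt_of_le (by positivity) hl1
      have hpos : 0 < EN := by
        have h := lt_of_lt_of_le hr₁ ha
        rw [lt_div_iff₀ p1] at h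
        linarith
      obtain ⟨π, hπ, b1, b2, b3⟩ := FB.per_code hch hM1 hM2 he1 he2 hP hN1 hN2 hi1 hi2 hE1 hE2 hE hpos hε herr
      have hI1 := FB.fbMI1_le hch0 hπ.1
      have hI2 := FB.fbMI2_le hch hπ.1
      rw [hπ.2, one_mul] at hI1 hI2
      obtain ⟨c1, c2, c3⟩ := FB.arith hr₁ hr₂ hs hε hε' (Real.log_nonneg (by norm_num)) hR1 hR2 ha hb hEs hl1 hl2
        hI1 hI2 b1 b2 b3
      exact ⟨π, hπ, by linarith, by linarith, by linarith⟩)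
  exact ⟨π, hπ, k1, k2, by linarith⟩

end
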